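/- arXiv:1306.3362 — 6 statements merged into one kernel-verified Lean document; each statement's English description precedes it below -/
import Mathlib

section
/- Let m ≥ 1 and let q_1, …, q_m ∈ [1,2] satisfy 1/q_1 + ⋯ + 1/q_m ≤ (m+1)/2. Then there exists a constant C ≥ 1 such that for every continuous m-linear form A : c₀ × ⋯ × c₀ → 𝕂 (𝕂 = ℝ or ℂ), the iterated mixed norm ( Σ_{i_1} ( Σ_{i_2} ( … ( Σ_{i_{m-1}} ( Σ_{i_m} |A(e_{i_1}, …, e_{i_m})|^{q_m} )^{q_{m-1}/q_m} )^{q_{m-2}/q_{m-1}} ⋯ )^{q_2/q_3} )^{q_1/q_2} )^{1/q_1} is at most C‖A‖. -/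
open scoped ENNReal NNReal

/-- Iterated mixed `ℓ_q`-norm of a family `a : ℕ^m → ℝ≥0∞` with exponents `q = (q 0, …, q (m-1))`:
`(Σ_{i₁} ( … ( Σ_{i_m} a_i ^ q_m )^{q_{m-1}/q_m} … )^{q_1/q_2})^{1/q_1}`. -/
noncomputable def mixedNorm : (m : ℕ) → (Fin m → ℝ) → ((Fin m → ℕ) → ℝ≥0∞) → ℝ≥0∞
  | 0, _, a => a finZeroElim
  | (m + 1), q, a =>
      (∑' i : ℕ, (mixedNorm m (fun j => q j.succ) (fun is => a (Fin.cons i is))) ^ q 0) ^ (1 / q 0)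

/-- The canonical unit vectors of `c₀`. -/
noncomputable def unitVec (𝕂 : Type*) [RCLike 𝕂] (i : ℕ) : ZeroAtInftyContinuousMap ℕ 𝕂 :=
  { toFun := fun j => if j = i then 1 else 0
    continuous_toFun := continuous_of_discreteTopology
    zero_at_infty' := by
      rw [Filter.cocompact_eq_cofinite]
      refine Filter.Tendsto.congr' ?_ tendsto_const_nhds
      filter_upwards [Filter.eventually_cofinite_ne i] with j hj
      simp [hj] }

section MixedNorm

theorem mixedNorm_mono {m : ℕ} {q : Fin m → ℝ} (hq : ∀ i, 0 ≤ q i)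
    {f g : (Fin m → ℕ) → ℝ≥0∞} (h : ∀ is, f is ≤ g is) : mixedNorm m q f ≤ mixedNorm m q g := by
  induction m with
  | zero => exact h _
  | succ m ih =>
    simp only [mixedNorm]
    refine ENNReal.rpow_le_rpow (ENNReal.tsum_le_tsum fun i => ?_) (one_div_nonneg.2 (hq 0))
    exact ENNReal.rpow_le_rpow (ih (fun j => hq j.succ) fun is => h _) (hq 0)

theorem mixedNorm_const_mul {m : ℕ} {q : Fin m → ℝ} (hq : ∀ i, 0 < q i) (c : ℝ≥0∞)
    (f : (Fin m → ℕ) → ℝ≥0∞) : mixedNorm m q (fun is => c * f is) = c * mixedNorm m q f := by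
  induction m with
  | zero => rfl
  | succ m ih =>
    simp only [mixedNorm]
    simp_rw [ih (q := fun j => q j.succ) (fun j => hq j.succ),
      ENNReal.mul_rpow_of_nonneg _ _ (hq 0).le]
    rw [ENNReal.tsum_mul_left, ENNReal.mul_rpow_of_nonneg _ _ (one_div_nonneg.2 (hq 0).le),
      one_div, ENNReal.rpow_rpow_inv (hq 0).ne']

theorem mixedNorm_zero {m : ℕ} {q : Fin m → ℝ} (hq : ∀ i, 0 < q i) :
    mixedNorm m q (fun _ => 0) = 0 := by
  simpa using mixedNorm_const_mul hq 0 (fun _ => 0)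

/-- Minkowski's inequality for infinite sums of `ℝ≥0∞`-valued functions. -/
theorem ENNReal.Lp_tsum_add_le {p : ℝ} (hp : 1 ≤ p) (f g : ℕ → ℝ≥0∞) :
    (∑' i, (f i + g i) ^ p) ^ (1 / p) ≤ (∑' i, f i ^ p) ^ (1 / p) + (∑' i, g i ^ p) ^ (1 / p) := by
  simpa [MeasureTheory.lintegral_count] using
    ENNReal.lintegral_Lp_add_le (μ := MeasureTheory.Measure.count) (f := f) (g := g)
      (measurable_of_countable f).aemeasurable (measurable_of_countable g).aemeasurable hp

theorem mixedNorm_add_le {m : ℕ} {q : Fin m → ℝ} (hq : ∀ i, 1 ≤ q i)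
    (f g : (Fin m → ℕ) → ℝ≥0∞) :
    mixedNorm m q (fun is => f is + g is) ≤ mixedNorm m q f + mixedNorm m q g := by
  induction m with
  | zero => exact le_rfl
  | succ m ih =>
    have h0 : (0 : ℝ) ≤ q 0 := zero_le_one.trans (hq 0)
    simp only [mixedNorm]
    refine le_trans ?_ (ENNReal.Lp_tsum_add_le (hq 0) _ _)
    refine ENNReal.rpow_le_rpow (ENNReal.tsum_le_tsum fun i => ?_) (one_div_nonneg.2 h0)
    exact ENNReal.rpow_le_rpow (ih (fun j => hq j.succ) _ _) h0

theorem mixedNorm_sum_le {m : ℕ} {q : Fin m → ℝ} (hq : ∀ i, 1 ≤ q i) {ι : Type*} (S : Finset ι)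
    (f : ι → (Fin m → ℕ) → ℝ≥0∞) :
    mixedNorm m q (fun is => ∑ s ∈ S, f s is) ≤ ∑ s ∈ S, mixedNorm m q (f s) := by
  classical
  induction S using Finset.induction_on with
  | empty => simp [mixedNorm_zero fun i => zero_lt_one.trans_le (hq i)]
  | insert a S ha ih =>
    simp only [Finset.sum_insert ha]
    exact (mixedNorm_add_le hq _ _).trans (by gcongr)

/-- The triangle inequality in `ℓ_p` of a finite set, for infinitely many summands. -/
theorem ENNReal.Lp_tsum_le {ι : Type*} (S : Finset ι) {p : ℝ} (hp : 1 ≤ p) (w : ℕ → ι → ℝ≥0∞) :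
    (∑ s ∈ S, (∑' j, w j s) ^ p) ^ (1 / p) ≤ ∑' j, (∑ s ∈ S, w j s ^ p) ^ (1 / p) := by
  classical
  have hp0 : 0 < p := zero_lt_one.trans_le hp
  have hfin (J : Finset ℕ) :
      (∑ s ∈ S, (∑ j ∈ J, w j s) ^ p) ^ (1 / p) ≤ ∑ j ∈ J, (∑ s ∈ S, w j s ^ p) ^ (1 / p) := by
    induction J using Finset.induction_on with
    | empty => simp [hp0]
    | insert a J ha ih =>
      simp only [Finset.sum_insert ha]
      exact (ENNReal.Lp_add_le _ _ _ hp).trans (by gcongr)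
  have hlim : Filter.Tendsto (fun J : Finset ℕ => (∑ s ∈ S, (∑ j ∈ J, w j s) ^ p) ^ (1 / p))
      Filter.atTop (nhds ((∑ s ∈ S, (∑' j, w j s) ^ p) ^ (1 / p))) :=
    (ENNReal.continuous_rpow_const.tendsto _).comp <| tendsto_finsetSum _ fun s _ =>
      (ENNReal.continuous_rpow_const.tendsto _).comp ENNReal.summable.hasSum
  exact le_of_tendsto' hlim fun J => (hfin J).trans (ENNReal.sum_le_tsum J)

/-- Mixed norms with exponents at most `2` are `2`-concave. -/
theorem sum_mixedNorm_sq_le {m : ℕ} {q : Fin m → ℝ} (hq : ∀ i, 0 < q i ∧ q i ≤ 2) {ι : Type*}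
    (S : Finset ι) (f : ι → (Fin m → ℕ) → ℝ≥0∞) :
    (∑ s ∈ S, mixedNorm m q (f s) ^ (2 : ℝ)) ^ (1 / 2 : ℝ) ≤
      mixedNorm m q (fun is => (∑ s ∈ S, f s is ^ (2 : ℝ)) ^ (1 / 2 : ℝ)) := by
  induction m with
  | zero => exact le_rfl
  | succ m ih =>
    obtain ⟨h0, h2⟩ := hq 0
    have hr : 1 ≤ 2 / q 0 := (one_le_div h0).2 h2
    simp only [mixedNorm]
    set u : ℕ → ι → ℝ≥0∞ := fun j s =>
      mixedNorm m (fun j => q j.succ) fun is => f s (Fin.cons j is)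
    calc (∑ s ∈ S, ((∑' j, u j s ^ q 0) ^ (1 / q 0)) ^ (2 : ℝ)) ^ (1 / 2 : ℝ)
        = ((∑ s ∈ S, (∑' j, u j s ^ q 0) ^ (2 / q 0)) ^ (1 / (2 / q 0))) ^ (1 / q 0) := by
          simp_rw [← ENNReal.rpow_mul]
          congr 1
          · simp [div_eq_mul_inv, mul_comm]
          · field_simp
      _ ≤ (∑' j, (∑ s ∈ S, (u j s ^ q 0) ^ (2 / q 0)) ^ (1 / (2 / q 0))) ^ (1 / q 0) := by
          gcongr
          exact ENNReal.Lp_tsum_le S hr _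
      _ = (∑' j, ((∑ s ∈ S, u j s ^ (2 : ℝ)) ^ (1 / 2 : ℝ)) ^ q 0) ^ (1 / q 0) := by
          have h₁ : q 0 * (2 / q 0) = 2 := by field_simp
          have h₂ : 1 / (2 / q 0) = 1 / 2 * q 0 := by field_simp
          simp_rw [← ENNReal.rpow_mul, h₁, h₂]
      _ ≤ _ := by
          refine ENNReal.rpow_le_rpow (ENNReal.tsum_le_tsum fun j => ?_) (one_div_nonneg.2 h0.le)
          exact ENNReal.rpow_le_rpow (ih (fun j => hq j.succ) _) h0.le

/-- Hölder's inequality for infinite sums and finitely many factors. -/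
theorem ENNReal.tsum_prod_rpow_le {ι : Type*} (S : Finset ι) (f : ι → ℕ → ℝ≥0∞) {w : ι → ℝ}
    (hw : ∑ s ∈ S, w s = 1) (hw0 : ∀ s ∈ S, 0 ≤ w s) :
    ∑' i, ∏ s ∈ S, f s i ^ w s ≤ ∏ s ∈ S, (∑' i, f s i) ^ w s := by
  simpa only [MeasureTheory.lintegral_count] using
    ENNReal.lintegral_prod_norm_pow_le (μ := MeasureTheory.Measure.count) S
      (fun s _ => (measurable_of_countable (f s)).aemeasurable) hw hw0

theorem ENNReal.prod_rpow_eq_rpow_sum {ι : Type*} (S : Finset ι) (x : ℝ≥0∞) {w : ι → ℝ}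
    (hw : ∀ s ∈ S, 0 ≤ w s) : ∏ s ∈ S, x ^ w s = x ^ ∑ s ∈ S, w s := by
  classical
  induction S using Finset.induction_on with
  | empty => simp
  | insert a S ha ih =>
    have hS : ∀ s ∈ S, 0 ≤ w s := fun s hs => hw s (Finset.mem_insert_of_mem hs)
    rw [Finset.prod_insert ha, Finset.sum_insert ha, ih hS,
      ENNReal.rpow_add_of_nonneg _ _ (hw a (Finset.mem_insert_self a S)) (Finset.sum_nonneg hS)]

/-- Hölder's inequality for mixed norms. -/
theorem mixedNorm_prod_rpow_le {m : ℕ} {ι : Type*} (S : Finset ι) {q : Fin m → ℝ}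
    {p : ι → Fin m → ℝ} {θ : ι → ℝ} (hq : ∀ i, 0 < q i) (hp : ∀ s ∈ S, ∀ i, 0 < p s i)
    (hθ : ∀ s ∈ S, 0 ≤ θ s) (hpq : ∀ i, ∑ s ∈ S, θ s / p s i = 1 / q i)
    (f : ι → (Fin m → ℕ) → ℝ≥0∞) :
    mixedNorm m q (fun is => ∏ s ∈ S, f s is ^ θ s) ≤ ∏ s ∈ S, mixedNorm m (p s) (f s) ^ θ s := by
  induction m with
  | zero => exact le_rfl
  | succ m ih =>
    have h0 := hq 0
    simp only [mixedNorm]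
    set u : ι → ℕ → ℝ≥0∞ := fun s j =>
      mixedNorm m (fun j => p s j.succ) fun is => f s (Fin.cons j is)
    calc _ ≤ (∑' j, (∏ s ∈ S, u s j ^ θ s) ^ q 0) ^ (1 / q 0) := by
          refine ENNReal.rpow_le_rpow (ENNReal.tsum_le_tsum fun j => ?_) (one_div_nonneg.2 h0.le)
          exact ENNReal.rpow_le_rpow (ih (fun j => hq j.succ) (fun s hs j => hp s hs j.succ)
            (fun j => hpq j.succ) _) h0.le
      _ = (∑' j, ∏ s ∈ S, (u s j ^ p s 0) ^ (θ s / p s 0 * q 0)) ^ (1 / q 0) := by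
          congr! 3 with j
          rw [← ENNReal.prod_rpow_of_nonneg h0.le]
          refine Finset.prod_congr rfl fun s hs => ?_
          have := (hp s hs 0).ne'
          rw [← ENNReal.rpow_mul, ← ENNReal.rpow_mul]
          congr 1
          field_simp
      _ ≤ (∏ s ∈ S, (∑' j, u s j ^ p s 0) ^ (θ s / p s 0 * q 0)) ^ (1 / q 0) := by
          gcongr
          refine ENNReal.tsum_prod_rpow_le S _ ?_ fun s hs =>
            mul_nonneg (div_nonneg (hθ s hs) (hp s hs 0).le) h0.le
          rw [← Finset.sum_mul, hpq, one_div_mul_cancel h0.ne']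
      _ = _ := by
          rw [← ENNReal.prod_rpow_of_nonneg (one_div_nonneg.2 h0.le)]
          refine Finset.prod_congr rfl fun s hs => ?_
          have := (hp s hs 0).ne'
          rw [← ENNReal.rpow_mul, ← ENNReal.rpow_mul]
          congr 1
          field_simp

end MixedNorm

section Khinchine

variable {𝕂 : Type*} [RCLike 𝕂]

/-- The sign pattern taking the value `1` on `T` and `-1` off `T`. -/
noncomputable def signOn (𝕂 : Type*) [RCLike 𝕂] (T : Finset ℕ) (i : ℕ) : 𝕂 :=
  if i ∈ T then 1 else -1

theorem norm_signOn (T : Finset ℕ) (i : ℕ) : ‖signOn 𝕂 T i‖ = 1 := by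
  unfold signOn
  split_ifs <;> simp

theorem sum_powerset_insert_signOn {a : ℕ} {S : Finset ℕ} (ha : a ∉ S) (c : ℕ → 𝕂) (F : 𝕂 → ℝ) :
    ∑ T ∈ (insert a S).powerset, F (∑ i ∈ insert a S, signOn 𝕂 T i * c i) =
      ∑ T ∈ S.powerset, (F (∑ i ∈ S, signOn 𝕂 T i * c i + c a) +
        F (∑ i ∈ S, signOn 𝕂 T i * c i - c a)) := by
  rw [Finset.sum_powerset_insert ha, ← Finset.sum_add_distrib]
  refine Finset.sum_congr rfl fun T hT => ?_
  have haT : a ∉ T := fun h => ha (Finset.mem_powerset.1 hT h)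
  have h (i : ℕ) (hi : i ∈ S) : signOn 𝕂 (insert a T) i * c i = signOn 𝕂 T i * c i := by
    have : i ≠ a := fun h => ha (h ▸ hi)
    simp [signOn, this]
  rw [Finset.sum_insert ha, Finset.sum_insert ha, Finset.sum_congr rfl h, add_comm]
  simp [signOn, haT, add_comm, sub_eq_add_neg]

theorem sum_signOn_norm_sq (S : Finset ℕ) (c : ℕ → 𝕂) :
    ∑ T ∈ S.powerset, ‖∑ i ∈ S, signOn 𝕂 T i * c i‖ ^ 2 = 2 ^ S.card * ∑ i ∈ S, ‖c i‖ ^ 2 := by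
  induction S using Finset.induction_on with
  | empty => simp
  | insert a S ha ih =>
    have h (x : 𝕂) : ‖x + c a‖ ^ 2 + ‖x - c a‖ ^ 2 = 2 * ‖x‖ ^ 2 + 2 * ‖c a‖ ^ 2 := by
      have := parallelogram_law_with_norm 𝕂 x (c a)
      linarith
    rw [sum_powerset_insert_signOn ha c fun x => ‖x‖ ^ 2]
    simp_rw [h]
    rw [Finset.sum_add_distrib, ← Finset.mul_sum, ih, Finset.sum_const, Finset.card_powerset,
      Finset.card_insert_of_notMem ha, Finset.sum_insert ha, nsmul_eq_mul]
    push_cast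
    ring

theorem norm_add_pow_four_add_norm_sub_pow_four_le (x y : 𝕂) :
    ‖x + y‖ ^ 4 + ‖x - y‖ ^ 4 ≤ 2 * ‖x‖ ^ 4 + 12 * ‖x‖ ^ 2 * ‖y‖ ^ 2 + 2 * ‖y‖ ^ 4 := by
  have hpar := parallelogram_law_with_norm 𝕂 x y
  have hadd : ‖x + y‖ ^ 2 ≤ (‖x‖ + ‖y‖) ^ 2 := by gcongr; exact norm_add_le x y
  have hsub : ‖x - y‖ ^ 2 ≤ (‖x‖ + ‖y‖) ^ 2 := by gcongr; exact norm_sub_le x y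
  have hdiff : (‖x + y‖ ^ 2 - ‖x - y‖ ^ 2) ^ 2 ≤ (4 * (‖x‖ * ‖y‖)) ^ 2 := by
    apply sq_le_sq' <;> nlinarith
  have hsum : ‖x + y‖ ^ 2 + ‖x - y‖ ^ 2 = 2 * (‖x‖ ^ 2 + ‖y‖ ^ 2) := by linarith
  have hsq := congrArg (· ^ 2) hsum
  linarith

theorem sum_signOn_norm_pow_four_le (S : Finset ℕ) (c : ℕ → 𝕂) :
    ∑ T ∈ S.powerset, ‖∑ i ∈ S, signOn 𝕂 T i * c i‖ ^ 4 ≤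
      3 * 2 ^ S.card * (∑ i ∈ S, ‖c i‖ ^ 2) ^ 2 := by
  induction S using Finset.induction_on with
  | empty => simp
  | insert a S ha ih =>
    rw [sum_powerset_insert_signOn ha c fun x => ‖x‖ ^ 4]
    refine (Finset.sum_le_sum fun T _ =>
      norm_add_pow_four_add_norm_sub_pow_four_le _ (c a)).trans ?_
    rw [Finset.sum_add_distrib, Finset.sum_add_distrib, ← Finset.mul_sum, ← Finset.sum_mul,
      ← Finset.mul_sum, sum_signOn_norm_sq, Finset.sum_const, Finset.card_powerset,
      Finset.card_insert_of_notMem ha, Finset.sum_insert ha, nsmul_eq_mul]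
    push_cast
    have : 0 ≤ 2 ^ S.card * ‖c a‖ ^ 4 := by positivity
    rw [pow_succ (2 : ℝ) S.card]
    linarith

/-- **Khinchine's inequality** between the first and second moments, with constant `2`. -/
theorem khinchine (S : Finset ℕ) (c : ℕ → 𝕂) :
    2 ^ S.card * √(∑ i ∈ S, ‖c i‖ ^ 2) ≤
      2 * ∑ T ∈ S.powerset, ‖∑ i ∈ S, signOn 𝕂 T i * c i‖ := by
  set σ := √(∑ i ∈ S, ‖c i‖ ^ 2) with hσ
  have hσ2 : ∑ i ∈ S, ‖c i‖ ^ 2 = σ ^ 2 := (Real.sq_sqrt (by positivity)).symm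
  have hσ0 : 0 ≤ σ := Real.sqrt_nonneg _
  obtain h0 | hpos := hσ0.eq_or_lt
  · rw [← h0]
    simp only [mul_zero]
    positivity
  have hpoly (x : ℝ) (hx : 0 ≤ x) : 6 * σ ^ 2 * x ^ 2 - x ^ 4 ≤ 6 * σ ^ 3 * x := by
    have h₁ : 0 ≤ x * ((x - 10 / 7 * σ) ^ 2 * (x + 20 / 7 * σ)) := by positivity
    have h₂ : 0 ≤ σ ^ 2 * x ^ 2 := by positivity
    have h₃ : 0 ≤ σ ^ 3 * x := by positivity
    linarith
  have hsum := Finset.sum_le_sum fun T (_ : T ∈ S.powerset) =>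
    hpoly ‖∑ i ∈ S, signOn 𝕂 T i * c i‖ (norm_nonneg _)
  rw [Finset.sum_sub_distrib, ← Finset.mul_sum, ← Finset.mul_sum, sum_signOn_norm_sq, hσ2] at hsum
  have h4 := sum_signOn_norm_pow_four_le S c
  rw [hσ2] at h4
  refine le_of_mul_le_mul_left ?_ (by positivity : 0 < 3 * σ ^ 3)
  linarith

theorem khinchine_enorm (S : Finset ℕ) (c : ℕ → 𝕂) :
    (∑ i ∈ S, ‖c i‖ₑ ^ (2 : ℝ)) ^ (1 / 2 : ℝ) ≤
      2 * (2 ^ S.card)⁻¹ * ∑ T ∈ S.powerset, ‖∑ i ∈ S, signOn 𝕂 T i * c i‖ₑ := by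
  have hl : (∑ i ∈ S, ‖c i‖ₑ ^ (2 : ℝ)) ^ (1 / 2 : ℝ) =
      ENNReal.ofReal √(∑ i ∈ S, ‖c i‖ ^ 2) := by
    rw [Real.sqrt_eq_rpow, ← ENNReal.ofReal_rpow_of_nonneg (by positivity) (by norm_num),
      ENNReal.ofReal_sum_of_nonneg fun i _ => by positivity]
    simp [ENNReal.ofReal_pow]
  have hr : 2 * (2 ^ S.card)⁻¹ * ∑ T ∈ S.powerset, ‖∑ i ∈ S, signOn 𝕂 T i * c i‖ₑ =
      ENNReal.ofReal (2 * (2 ^ S.card)⁻¹ *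
        ∑ T ∈ S.powerset, ‖∑ i ∈ S, signOn 𝕂 T i * c i‖) := by
    rw [ENNReal.ofReal_mul (by positivity), ENNReal.ofReal_mul (by positivity),
      ENNReal.ofReal_inv_of_pos (by positivity), ENNReal.ofReal_pow (by positivity),
      ENNReal.ofReal_sum_of_nonneg fun i _ => norm_nonneg _]
    simp
  rw [hl, hr]
  refine ENNReal.ofReal_le_ofReal ?_
  rw [mul_right_comm, ← div_eq_mul_inv, le_div_iff₀' (by positivity)]
  exact khinchine S c

theorem sum_mixedNorm_sq_le_sum_signOn {m : ℕ} {q : Fin m → ℝ} (hq : ∀ i, 1 ≤ q i ∧ q i ≤ 2)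
    (S : Finset ℕ) (f : ℕ → (Fin m → ℕ) → 𝕂) :
    (∑ i ∈ S, mixedNorm m q (fun is => ‖f i is‖ₑ) ^ (2 : ℝ)) ^ (1 / 2 : ℝ) ≤
      2 * (2 ^ S.card)⁻¹ *
        ∑ T ∈ S.powerset, mixedNorm m q (fun is => ‖∑ i ∈ S, signOn 𝕂 T i * f i is‖ₑ) := by
  have hpos (i : Fin m) : 0 < q i := zero_lt_one.trans_le (hq i).1
  refine (sum_mixedNorm_sq_le (fun i => ⟨hpos i, (hq i).2⟩) S _).trans ?_
  refine (mixedNorm_mono (fun i => (hpos i).le) fun is =>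
    khinchine_enorm S fun i => f i is).trans ?_
  rw [mixedNorm_const_mul hpos]
  gcongr
  exact mixedNorm_sum_le (fun i => (hq i).1) _ _

theorem sum_tsum_mixedNorm_sq_le {m : ℕ} {q : Fin m → ℝ} (hq : ∀ i, 1 ≤ q i ∧ q i ≤ 2)
    {ι : Type*} (S : Finset ι) (f : ι → ℕ → (Fin m → ℕ) → 𝕂) {B : ℝ≥0∞}
    (hB : ∀ I T : Finset ℕ,
      ∑ s ∈ S, mixedNorm m q (fun is => ‖∑ i ∈ I, signOn 𝕂 T i * f s i is‖ₑ) ≤ B) :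
    ∑ s ∈ S, (∑' i, mixedNorm m q (fun is => ‖f s i is‖ₑ) ^ (2 : ℝ)) ^ (1 / 2 : ℝ) ≤ 2 * B := by
  have hlim : Filter.Tendsto (fun I : Finset ℕ => ∑ s ∈ S,
      (∑ i ∈ I, mixedNorm m q (fun is => ‖f s i is‖ₑ) ^ (2 : ℝ)) ^ (1 / 2 : ℝ)) Filter.atTop
      (nhds (∑ s ∈ S,
        (∑' i, mixedNorm m q (fun is => ‖f s i is‖ₑ) ^ (2 : ℝ)) ^ (1 / 2 : ℝ))) :=
    tendsto_finsetSum _ fun s _ =>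
      (ENNReal.continuous_rpow_const.tendsto _).comp ENNReal.summable.hasSum
  refine le_of_tendsto' hlim fun I => ?_
  calc _ ≤ ∑ s ∈ S, 2 * (2 ^ I.card)⁻¹ * ∑ T ∈ I.powerset,
        mixedNorm m q (fun is => ‖∑ i ∈ I, signOn 𝕂 T i * f s i is‖ₑ) :=
        Finset.sum_le_sum fun s _ => sum_mixedNorm_sq_le_sum_signOn hq I (f s)
    _ = 2 * (2 ^ I.card)⁻¹ * ∑ T ∈ I.powerset, ∑ s ∈ S,
        mixedNorm m q (fun is => ‖∑ i ∈ I, signOn 𝕂 T i * f s i is‖ₑ) := by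
        rw [← Finset.mul_sum, Finset.sum_comm]
    _ ≤ 2 * (2 ^ I.card)⁻¹ * ∑ T ∈ I.powerset, B := by
        gcongr with T
        exact hB I T
    _ = 2 * B := by
        rw [Finset.sum_const, Finset.card_powerset, nsmul_eq_mul, mul_assoc, ← mul_assoc _ _ B]
        push_cast
        rw [ENNReal.inv_mul_cancel (by simp) (by simp), one_mul]

end Khinchine

section Forms

variable {𝕂 : Type*} [RCLike 𝕂]

theorem norm_sum_smul_unitVec_le (S : Finset ℕ) {c : ℕ → 𝕂} (hc : ∀ i, ‖c i‖ ≤ 1) :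
    ‖∑ i ∈ S, c i • unitVec 𝕂 i‖ ≤ 1 := by
  have happ (j : ℕ) : (∑ i ∈ S, c i • unitVec 𝕂 i) j = if j ∈ S then c j else 0 := by
    induction S using Finset.induction_on with
    | empty => simp
    | insert a S ha ih =>
      rw [Finset.sum_insert ha, ZeroAtInftyContinuousMap.add_apply, ih,
        ZeroAtInftyContinuousMap.smul_apply]
      by_cases h : j = a
      · subst h
        simp [unitVec, ha]
      · simp [unitVec, h]
  rw [← ZeroAtInftyContinuousMap.norm_toBCF_eq_norm,
    BoundedContinuousFunction.norm_le zero_le_one]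
  intro j
  change ‖(∑ i ∈ S, c i • unitVec 𝕂 i) j‖ ≤ 1
  rw [happ]
  split_ifs
  · exact hc j
  · simp

theorem norm_unitVec_le (i : ℕ) : ‖unitVec 𝕂 i‖ ≤ 1 := by
  simpa using norm_sum_smul_unitVec_le {i} (c := fun _ => (1 : 𝕂)) (by simp)

variable {m : ℕ}

theorem apply_unitVec_cons (A : ContinuousMultilinearMap 𝕂
    (fun _ : Fin (m + 1) => ZeroAtInftyContinuousMap ℕ 𝕂) 𝕂) (i : ℕ) (is : Fin m → ℕ) :
    A (fun k => unitVec 𝕂 ((Fin.cons i is : Fin (m + 1) → ℕ) k)) =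
      A.curryLeft (unitVec 𝕂 i) fun k => unitVec 𝕂 (is k) := by
  rw [ContinuousMultilinearMap.curryLeft_apply]
  congr 1
  funext k
  cases k using Fin.cases <;> rfl

theorem curryLeft_sum_smul_apply (A : ContinuousMultilinearMap 𝕂
    (fun _ : Fin (m + 1) => ZeroAtInftyContinuousMap ℕ 𝕂) 𝕂) (S : Finset ℕ) (c : ℕ → 𝕂)
    (x : Fin m → ZeroAtInftyContinuousMap ℕ 𝕂) :
    A.curryLeft (∑ i ∈ S, c i • unitVec 𝕂 i) x =
      ∑ i ∈ S, c i * A.curryLeft (unitVec 𝕂 i) x := by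
  simp [map_sum]

theorem norm_curryLeft_apply_le (A : ContinuousMultilinearMap 𝕂
    (fun _ : Fin (m + 1) => ZeroAtInftyContinuousMap ℕ 𝕂) 𝕂) {x : ZeroAtInftyContinuousMap ℕ 𝕂}
    (hx : ‖x‖ ≤ 1) : ‖A.curryLeft x‖ ≤ ‖A‖ := by
  refine ContinuousMultilinearMap.opNorm_le_bound (norm_nonneg A) fun y => ?_
  refine (A.norm_map_cons_le x y).trans ?_
  gcongr
  exact mul_le_of_le_one_right (norm_nonneg A) hx

theorem sum_norm_curryLeft_unitVec_le (A : ContinuousMultilinearMap 𝕂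
    (fun _ : Fin (m + 1) => ZeroAtInftyContinuousMap ℕ 𝕂) 𝕂) (S : Finset ℕ)
    {x : Fin m → ZeroAtInftyContinuousMap ℕ 𝕂} (hx : ∀ k, ‖x k‖ ≤ 1) :
    ∑ i ∈ S, ‖A.curryLeft (unitVec 𝕂 i) x‖ ≤ ‖A‖ := by
  choose c hc hcA using fun i => RCLike.exists_norm_eq_mul_self (A.curryLeft (unitVec 𝕂 i) x)
  have h : ((∑ i ∈ S, ‖A.curryLeft (unitVec 𝕂 i) x‖ : ℝ) : 𝕂) =
      A.curryLeft (∑ i ∈ S, c i • unitVec 𝕂 i) x := by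
    rw [curryLeft_sum_smul_apply]
    push_cast
    exact Finset.sum_congr rfl fun i _ => hcA i
  have hnn : 0 ≤ ∑ i ∈ S, ‖A.curryLeft (unitVec 𝕂 i) x‖ := by positivity
  calc _ = ‖A.curryLeft (∑ i ∈ S, c i • unitVec 𝕂 i) x‖ := by
        rw [← h, RCLike.norm_ofReal, abs_of_nonneg hnn]
    _ ≤ ‖A.curryLeft (∑ i ∈ S, c i • unitVec 𝕂 i)‖ :=
        ContinuousMultilinearMap.unit_le_opNorm _ (pi_norm_le_iff_of_nonneg zero_le_one |>.2 hx)
    _ ≤ ‖A‖ := norm_curryLeft_apply_le A (norm_sum_smul_unitVec_le S fun i => (hc i).le)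

/-- The `ℓ_1(ℓ_2)` estimate for a finite family of forms whose pointwise `ℓ_1`-norm is bounded
on the unit ball. -/
theorem sum_mixedNorm_two_le {ι : Type*} (S : Finset ι)
    (A : ι → ContinuousMultilinearMap 𝕂 (fun _ : Fin m => ZeroAtInftyContinuousMap ℕ 𝕂) 𝕂)
    {M : ℝ≥0∞} (hA : ∀ x : Fin m → ZeroAtInftyContinuousMap ℕ 𝕂, (∀ k, ‖x k‖ ≤ 1) →
      ∑ s ∈ S, ‖A s x‖ₑ ≤ M) :
    ∑ s ∈ S, mixedNorm m (fun _ => 2) (fun is => ‖A s (fun k => unitVec 𝕂 (is k))‖ₑ) ≤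
      2 ^ m * M := by
  induction m with
  | zero =>
    simp only [mixedNorm, pow_zero, one_mul]
    exact hA _ fun k => k.elim0
  | succ m ih =>
    simp only [mixedNorm, pow_succ', mul_assoc, apply_unitVec_cons]
    refine sum_tsum_mixedNorm_sq_le (by norm_num) S _ fun I T => ?_
    simp only [← curryLeft_sum_smul_apply]
    refine ih _ fun x hx => ?_
    simp only [ContinuousMultilinearMap.curryLeft_apply]
    refine hA _ fun k => ?_
    cases k using Fin.cases with
    | zero => exact norm_sum_smul_unitVec_le I fun i => (norm_signOn T i).le
    | succ k => exact hx k

theorem mixedNorm_two_le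
    (A : ContinuousMultilinearMap 𝕂 (fun _ : Fin m => ZeroAtInftyContinuousMap ℕ 𝕂) 𝕂) :
    mixedNorm m (fun _ => 2) (fun is => ‖A (fun k => unitVec 𝕂 (is k))‖ₑ) ≤ 2 ^ m * ‖A‖ₑ := by
  refine le_trans (by simp) (sum_mixedNorm_two_le {()} (fun _ => A) fun x hx => ?_)
  rw [Finset.sum_singleton, enorm_le_iff_norm_le]
  exact A.unit_le_opNorm (pi_norm_le_iff_of_nonneg zero_le_one |>.2 hx)

/-- The mixed `(ℓ_1, ℓ_2)`-estimate with the exponent `1` in an arbitrary position. -/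
theorem mixedNorm_update_two_one_le (k : Fin m)
    (A : ContinuousMultilinearMap 𝕂 (fun _ : Fin m => ZeroAtInftyContinuousMap ℕ 𝕂) 𝕂) :
    mixedNorm m (Function.update (fun _ => 2) k 1)
      (fun is => ‖A (fun k => unitVec 𝕂 (is k))‖ₑ) ≤ 2 ^ m * ‖A‖ₑ := by
  induction m with
  | zero => exact k.elim0
  | succ m ih =>
    simp only [mixedNorm, apply_unitVec_cons]
    cases k using Fin.cases with
    | zero =>
      simp only [Function.update_self, ENNReal.rpow_one, div_one,
        Function.update_of_ne (Fin.succ_ne_zero _)]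
      refine ENNReal.summable.tsum_le_of_sum_le fun S => ?_
      refine (sum_mixedNorm_two_le S (fun i => A.curryLeft (unitVec 𝕂 i)) (M := ‖A‖ₑ)
        fun x hx => ?_).trans ?_
      · simp_rw [← ofReal_norm]
        rw [← ENNReal.ofReal_sum_of_nonneg fun i _ => norm_nonneg _]
        exact ENNReal.ofReal_le_ofReal (sum_norm_curryLeft_unitVec_le A S hx)
      · gcongr <;> simp
    | succ k =>
      have htail : (fun j : Fin m => (Function.update (fun _ => 2) k.succ 1 : Fin (m + 1) → ℝ)
          j.succ) = Function.update (fun _ => 2) k 1 := by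
        funext j
        simp [Function.update_apply]
      rw [htail, Function.update_of_ne (Fin.succ_ne_zero k).symm]
      refine le_trans (le_of_eq ?_) ((sum_tsum_mixedNorm_sq_le (𝕂 := 𝕂)
        (q := Function.update (fun _ => 2) k 1) (B := 2 ^ m * ‖A‖ₑ) (fun j => ?_) {()}
        (fun _ i is => A.curryLeft (unitVec 𝕂 i) fun k => unitVec 𝕂 (is k))
        fun I T => ?_).trans_eq ?_)
      · rw [Finset.sum_singleton]
      · rw [Function.update_apply]
        split_ifs <;> norm_num
      · simp only [← curryLeft_sum_smul_apply, Finset.sum_singleton]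
        refine (ih k _).trans ?_
        gcongr
        rw [enorm_le_iff_norm_le]
        exact norm_curryLeft_apply_le A
          (norm_sum_smul_unitVec_le I fun i => (norm_signOn T i).le)
      · rw [pow_succ', mul_assoc]

end Forms

/-- **Sharp generalized Bohnenblust–Hille inequality, sufficiency.**
If `m ≥ 1`, `q₁, …, q_m ∈ [1,2]` and `1/q₁ + ⋯ + 1/q_m ≤ (m+1)/2`, then there is a constant
`C ≥ 1` such that the iterated mixed norm of `(A(e_{i₁}, …, e_{i_m}))` is at most `C‖A‖` for
every continuous `m`-linear form `A` on `c₀ × ⋯ × c₀` (over `𝕂 = ℝ` or `ℂ`). -/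
theorem generalized_BH_sufficiency (𝕂 : Type*) [RCLike 𝕂] (m : ℕ) (hm : 1 ≤ m)
    (q : Fin m → ℝ) (hq : ∀ i, 1 ≤ q i ∧ q i ≤ 2)
    (hsum : ∑ i, 1 / q i ≤ (m + 1) / 2) :
    ∃ C : ℝ, 1 ≤ C ∧
      ∀ A : ContinuousMultilinearMap 𝕂 (fun _ : Fin m => ZeroAtInftyContinuousMap ℕ 𝕂) 𝕂,
        mixedNorm m q (fun is => (‖A (fun k => unitVec 𝕂 (is k))‖₊ : ℝ≥0∞)) ≤
          ENNReal.ofReal (C * ‖A‖) := by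
  classical
  have hpos (i : Fin m) : 0 < q i := zero_lt_one.trans_le (hq i).1
  set t : Fin m → ℝ := fun i => 2 / q i - 1 with ht
  set θ : Option (Fin m) → ℝ := fun s => s.elim (1 - ∑ i, t i) t with hθ
  set p : Option (Fin m) → Fin m → ℝ :=
    fun s => s.elim (fun _ => 2) fun k => Function.update (fun _ => 2) k 1 with hp
  have ht0 (i : Fin m) : 0 ≤ t i := sub_nonneg.2 ((one_le_div (hpos i)).2 (hq i).2)
  have htsum : ∑ i, t i ≤ 1 := by
    have h : ∑ i, t i = 2 * ∑ i, 1 / q i - m := by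
      simp [ht, Finset.mul_sum, div_eq_mul_inv]
    linarith
  have hθ0 (s : Option (Fin m)) : 0 ≤ θ s := by
    cases s with
    | none => exact sub_nonneg.2 htsum
    | some k => exact ht0 k
  have hθsum : ∑ s, θ s = 1 := by simp [hθ, Fintype.sum_option]
  have hp0 (s : Option (Fin m)) (i : Fin m) : 0 < p s i := by
    cases s with
    | none => exact two_pos
    | some k =>
      simp only [hp, Option.elim, Function.update_apply]
      split_ifs <;> norm_num
  have hpq (i : Fin m) : ∑ s, θ s / p s i = 1 / q i := by
    have hk (k : Fin m) : t k / (Function.update (fun _ => 2) k 1 : Fin m → ℝ) i =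
        t k / 2 + if i = k then t k / 2 else 0 := by
      rw [Function.update_apply]
      split_ifs <;> ring
    simp only [hθ, hp, Fintype.sum_option, Option.elim, hk, Finset.sum_add_distrib,
      Finset.sum_ite_eq, Finset.mem_univ, if_true, ← Finset.sum_div]
    simp only [ht]
    ring
  refine ⟨2 ^ m, one_le_pow₀ one_le_two, fun A => ?_⟩
  have hbound (s : Option (Fin m)) :
      mixedNorm m (p s) (fun is => ‖A (fun k => unitVec 𝕂 (is k))‖ₑ) ≤ 2 ^ m * ‖A‖ₑ := by
    cases s with
    | none => exact mixedNorm_two_le A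
    | some k => exact mixedNorm_update_two_one_le k A
  calc mixedNorm m q (fun is => ‖A (fun k => unitVec 𝕂 (is k))‖ₑ)
      = mixedNorm m q (fun is => ∏ s, ‖A (fun k => unitVec 𝕂 (is k))‖ₑ ^ θ s) := by
        congr! 2 with is
        rw [ENNReal.prod_rpow_eq_rpow_sum _ _ fun s _ => hθ0 s, hθsum, ENNReal.rpow_one]
    _ ≤ ∏ s, mixedNorm m (p s) (fun is => ‖A (fun k => unitVec 𝕂 (is k))‖ₑ) ^ θ s :=
        mixedNorm_prod_rpow_le Finset.univ hpos (fun s _ => hp0 s) (fun s _ => hθ0 s) hpq _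
    _ ≤ ∏ s, (2 ^ m * ‖A‖ₑ) ^ θ s := by
        gcongr with s
        · exact hθ0 s
        · exact hbound s
    _ = 2 ^ m * ‖A‖ₑ := by
        rw [ENNReal.prod_rpow_eq_rpow_sum _ _ fun s _ => hθ0 s, hθsum, ENNReal.rpow_one]
    _ = ENNReal.ofReal (2 ^ m * ‖A‖) := by
        rw [ENNReal.ofReal_mul (by positivity), ENNReal.ofReal_pow (by positivity)]
        rw [ENNReal.ofReal_ofNat]
        exact congrArg _ (ofReal_norm A).symm
end

section
/- Let m ≥ 1 and q_1, …, q_m ∈ [1,2]. If there exists a constant C ≥ 1 such that for every continuous m-linear form A : c₀ × ⋯ × c₀ → ℂ one has ( Σ_{i_1} ( Σ_{i_2} ( … ( Σ_{i_m} |A(e_{i_1}, …, e_{i_m})|^{q_m} )^{q_{m-1}/q_m} ⋯ )^{q_2/q_3} )^{q_1/q_2} )^{1/q_1} ≤ C‖A‖, then necessarily 1/q_1 + ⋯ + 1/q_m ≤ (m+1)/2. -/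
open scoped ENNReal NNReal

/-- Iterated sums dominate `n ^ ∑ 1 / q i` when the family is at least `1` on the cube `[0, n)^m`. -/
theorem rpow_sum_le_mixedNorm (n : ℕ) (hn : n ≠ 0) : ∀ (m : ℕ) (q : Fin m → ℝ)
    (_ : ∀ i, 0 < q i) (a : (Fin m → ℕ) → ℝ≥0∞) (_ : ∀ is, (∀ k, is k < n) → 1 ≤ a is),
    (n : ℝ≥0∞) ^ (∑ i, 1 / q i) ≤ mixedNorm m q a
  | 0, q, _, a, ha => by
      simpa [mixedNorm] using ha finZeroElim (fun k => k.elim0)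
  | m + 1, q, hq, a, ha => by
      have hn0 : (n : ℝ≥0∞) ≠ 0 := by exact_mod_cast hn
      have hnt : (n : ℝ≥0∞) ≠ ∞ := ENNReal.natCast_ne_top n
      have hq0 := hq 0
      set s := ∑ i : Fin m, 1 / q i.succ with hs
      have hinner (i : ℕ) (hi : i < n) : (n : ℝ≥0∞) ^ s ≤
          mixedNorm m (fun j => q j.succ) (fun is => a (Fin.cons i is)) :=
        rpow_sum_le_mixedNorm n hn m _ (fun j => hq j.succ) _ fun is his =>
          ha _ fun k => Fin.cases hi his k
      calc (n : ℝ≥0∞) ^ (∑ i, 1 / q i)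
          = (∑ _i ∈ Finset.range n, ((n : ℝ≥0∞) ^ s) ^ q 0) ^ (1 / q 0) := by
            rw [Fin.sum_univ_succ, ← hs, Finset.sum_const, Finset.card_range, nsmul_eq_mul,
              ENNReal.mul_rpow_of_nonneg _ _ (by positivity), ENNReal.rpow_add _ _ hn0 hnt,
              ← ENNReal.rpow_mul, ← ENNReal.rpow_mul]
            congr 2
            field_simp
        _ ≤ _ := by
            rw [mixedNorm]
            refine ENNReal.rpow_le_rpow ?_ (by positivity)
            refine le_trans (Finset.sum_le_sum fun i hi => ?_) (ENNReal.sum_le_tsum (Finset.range n))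
            exact ENNReal.rpow_le_rpow (hinner i (Finset.mem_range.1 hi)) hq0.le

/-- Parseval's identity for the `n × n` Fourier matrix `(ω ^ (i * j))`. -/
theorem IsPrimitiveRoot.sum_norm_sq_sum_pow_mul {n : ℕ} (hn : n ≠ 0) {ω : ℂ}
    (hω : IsPrimitiveRoot ω n) (y : ℕ → ℂ) :
    ∑ i ∈ Finset.range n, ‖∑ j ∈ Finset.range n, ω ^ (i * j) * y j‖ ^ 2 =
      n * ∑ j ∈ Finset.range n, ‖y j‖ ^ 2 := by
  have hnorm : ‖ω‖ = 1 := hω.norm'_eq_one hn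
  have horth (j : ℕ) (hj : j < n) (k : ℕ) (hk : k < n) :
      ∑ i ∈ Finset.range n, (ω ^ j * starRingEnd ℂ (ω ^ k)) ^ i = if j = k then (n : ℂ) else 0 := by
    have hinv : starRingEnd ℂ (ω ^ k) = (ω ^ k)⁻¹ := by
      rw [Complex.inv_eq_conj (by simp [hnorm])]
    have hk0 : ω ^ k ≠ 0 := pow_ne_zero _ (hω.ne_zero hn)
    rw [hinv]
    split_ifs with hjk
    · subst hjk
      simp [hk0]
    · have hne : ω ^ j * (ω ^ k)⁻¹ ≠ 1 := fun h1 =>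
        hjk (hω.pow_inj hj hk ((mul_inv_eq_one₀ hk0).1 h1))
      rw [geom_sum_eq hne, mul_pow, inv_pow, ← pow_mul, ← pow_mul, mul_comm j, mul_comm k,
        pow_mul, pow_mul, hω.pow_eq_one]
      simp
  rw [← Complex.ofReal_inj]
  push_cast
  simp only [← Complex.mul_conj', map_sum, Finset.sum_mul_sum]
  rw [Finset.sum_comm, Finset.mul_sum]
  refine Finset.sum_congr rfl fun j hj => ?_
  rw [Finset.sum_comm]
  calc _ = ∑ k ∈ Finset.range n, (y j * starRingEnd ℂ (y k)) *
        ∑ i ∈ Finset.range n, (ω ^ j * starRingEnd ℂ (ω ^ k)) ^ i := by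
        refine Finset.sum_congr rfl fun k _ => ?_
        rw [Finset.mul_sum]
        refine Finset.sum_congr rfl fun i _ => ?_
        rw [map_mul, mul_pow, ← map_pow, ← pow_mul, ← pow_mul, mul_comm j, mul_comm k]
        ring
    _ = ∑ k ∈ Finset.range n, (y j * starRingEnd ℂ (y k)) * if j = k then (n : ℂ) else 0 :=
        Finset.sum_congr rfl fun k hk => by
          rw [horth j (Finset.mem_range.1 hj) k (Finset.mem_range.1 hk)]
    _ = _ := by
        simp only [mul_ite, mul_zero]
        rw [Finset.sum_ite_eq, if_pos hj]
        ring

theorem ZeroAtInftyContinuousMap.norm_apply_le_norm (f : ZeroAtInftyContinuousMap ℕ ℂ) (i : ℕ) :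
    ‖f i‖ ≤ ‖f‖ := by
  rw [← ZeroAtInftyContinuousMap.norm_toBCF_eq_norm]
  exact f.toBCF.norm_coe_le_norm i

/-- The `i`-th coordinate functional on `c₀`. -/
noncomputable def coordCLM (i : ℕ) : ZeroAtInftyContinuousMap ℕ ℂ →L[ℂ] ℂ :=
  LinearMap.mkContinuous
    { toFun := fun f => f i
      map_add' := fun _ _ => rfl
      map_smul' := fun _ _ => rfl } 1 fun f => by
        simpa using ZeroAtInftyContinuousMap.norm_apply_le_norm f i

@[simp]
theorem coordCLM_apply (i : ℕ) (f : ZeroAtInftyContinuousMap ℕ ℂ) : coordCLM i f = f i := rfl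

/-- The `m`-linear form `x ↦ ∑ ω ^ (i₁ i₂) ω ^ (i₂ i₃) ⋯ ω ^ (iₘ₋₁ iₘ) x₁(i₁) ⋯ xₘ(iₘ)`, where
`i₁ = i` is fixed and the other indices run over `[0, n)`. -/
noncomputable def fourierForm (ω : ℂ) (n : ℕ) : (m : ℕ) → ℕ →
    ContinuousMultilinearMap ℂ (fun _ : Fin m => ZeroAtInftyContinuousMap ℕ ℂ) ℂ
  | 0, i => ContinuousMultilinearMap.constOfIsEmpty ℂ _ (if i = 0 then 1 else 0)
  | m + 1, i => ContinuousLinearMap.uncurryLeft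
      (Ei := fun _ : Fin (m + 1) => ZeroAtInftyContinuousMap ℕ ℂ)
      ((coordCLM i).smulRight (∑ j ∈ Finset.range n, ω ^ (i * j) • fourierForm ω n m j))

theorem fourierForm_zero (ω : ℂ) (n i : ℕ) (x : Fin 0 → ZeroAtInftyContinuousMap ℕ ℂ) :
    fourierForm ω n 0 i x = if i = 0 then 1 else 0 := rfl

theorem fourierForm_succ (ω : ℂ) (n m i : ℕ) (x : Fin (m + 1) → ZeroAtInftyContinuousMap ℕ ℂ) :
    fourierForm ω n (m + 1) i x =
      x 0 i * ∑ j ∈ Finset.range n, ω ^ (i * j) * fourierForm ω n m j (Fin.tail x) := by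
  simp [fourierForm]

theorem sum_norm_sq_fourierForm_le {n : ℕ} (hn : n ≠ 0) {ω : ℂ} (hω : IsPrimitiveRoot ω n) :
    ∀ (m : ℕ) (x : Fin m → ZeroAtInftyContinuousMap ℕ ℂ),
      ∑ i ∈ Finset.range n, ‖fourierForm ω n m i x‖ ^ 2 ≤ n ^ m * (∏ k, ‖x k‖) ^ 2
  | 0, x => by
      have h0 (i : ℕ) : ‖fourierForm ω n 0 i x‖ ^ 2 = if i = 0 then 1 else 0 := by
        rw [fourierForm_zero]
        split_ifs <;> simp
      rw [Finset.sum_congr rfl fun i _ => h0 i]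
      simp [Nat.pos_of_ne_zero hn]
  | m + 1, x => by
      calc ∑ i ∈ Finset.range n, ‖fourierForm ω n (m + 1) i x‖ ^ 2
          ≤ ∑ i ∈ Finset.range n, ‖x 0‖ ^ 2 *
              ‖∑ j ∈ Finset.range n, ω ^ (i * j) * fourierForm ω n m j (Fin.tail x)‖ ^ 2 := by
            refine Finset.sum_le_sum fun i _ => ?_
            rw [fourierForm_succ, norm_mul, mul_pow]
            gcongr
            exact ZeroAtInftyContinuousMap.norm_apply_le_norm _ _
        _ = ‖x 0‖ ^ 2 * (n * ∑ j ∈ Finset.range n, ‖fourierForm ω n m j (Fin.tail x)‖ ^ 2) := by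
            rw [← Finset.mul_sum, hω.sum_norm_sq_sum_pow_mul hn]
        _ ≤ ‖x 0‖ ^ 2 * (n * (n ^ m * (∏ k, ‖Fin.tail x k‖) ^ 2)) := by
            gcongr
            exact sum_norm_sq_fourierForm_le hn hω m _
        _ = n ^ (m + 1) * (∏ k, ‖x k‖) ^ 2 := by
            rw [Fin.prod_univ_succ]
            simp only [Fin.tail]
            ring

theorem norm_sum_fourierForm_le {n : ℕ} (hn : n ≠ 0) {ω : ℂ} (hω : IsPrimitiveRoot ω n) (m : ℕ) :
    ‖∑ i ∈ Finset.range n, fourierForm ω n m i‖ ≤ (n : ℝ) ^ (((m : ℝ) + 1) / 2) := by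
  refine ContinuousMultilinearMap.opNorm_le_bound (by positivity) fun x => ?_
  rw [sum_apply]
  refine (norm_sum_le _ _).trans (abs_le_of_sq_le_sq' ?_ (by positivity)).2
  have hsq : ((n : ℝ) ^ (((m : ℝ) + 1) / 2)) ^ 2 = n * n ^ m := by
    rw [← Real.rpow_natCast, ← Real.rpow_mul (by positivity)]
    norm_num
    rw [← pow_succ']
    exact_mod_cast Real.rpow_natCast (n : ℝ) (m + 1)
  calc (∑ i ∈ Finset.range n, ‖fourierForm ω n m i x‖) ^ 2
      ≤ n * ∑ i ∈ Finset.range n, ‖fourierForm ω n m i x‖ ^ 2 := by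
        simpa using sq_sum_le_card_mul_sum_sq (s := Finset.range n)
          (f := fun i => ‖fourierForm ω n m i x‖)
    _ ≤ n * (n ^ m * (∏ k, ‖x k‖) ^ 2) := by
        gcongr
        exact sum_norm_sq_fourierForm_le hn hω m x
    _ = _ := by rw [mul_pow, hsq, mul_assoc]

theorem unitVec_apply (i j : ℕ) : unitVec ℂ i j = if j = i then 1 else 0 := rfl

theorem exists_fourierForm_unitVec_eq {n : ℕ} (hn : n ≠ 0) {ω : ℂ} (hω : ‖ω‖ = 1) :
    ∀ (m : ℕ) (is : Fin m → ℕ) (_ : ∀ k, is k < n), ∃ r < n, ∃ u : ℂ, ‖u‖ = 1 ∧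
      ∀ j, fourierForm ω n m j (fun k => unitVec ℂ (is k)) = if j = r then u else 0
  | 0, _, _ => ⟨0, Nat.pos_of_ne_zero hn, 1, by simp, fun j => fourierForm_zero ω n j _⟩
  | m + 1, is, his => by
      obtain ⟨r, hr, u, hu, h⟩ :=
        exists_fourierForm_unitVec_eq hn hω m (Fin.tail is) fun k => his k.succ
      refine ⟨is 0, his 0, ω ^ (is 0 * r) * u, by simp [hω, hu], fun j => ?_⟩
      have htail : Fin.tail (fun k => unitVec ℂ (is k)) = fun k => unitVec ℂ (Fin.tail is k) := rfl
      rw [fourierForm_succ, htail, unitVec_apply]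
      simp only [h, mul_ite, mul_zero]
      rw [Finset.sum_ite_eq', if_pos (Finset.mem_range.2 hr)]
      split_ifs with hj
      · rw [hj, one_mul]
      · rw [zero_mul]

theorem norm_sum_fourierForm_unitVec {n : ℕ} (hn : n ≠ 0) {ω : ℂ} (hω : ‖ω‖ = 1) {m : ℕ}
    (is : Fin m → ℕ) (his : ∀ k, is k < n) :
    ‖(∑ j ∈ Finset.range n, fourierForm ω n m j) (fun k => unitVec ℂ (is k))‖₊ = 1 := by
  obtain ⟨r, hr, u, hu, h⟩ := exists_fourierForm_unitVec_eq hn hω m is his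
  rw [sum_apply]
  simp only [h]
  rw [Finset.sum_ite_eq', if_pos (Finset.mem_range.2 hr)]
  exact NNReal.eq hu

theorem le_of_forall_natCast_rpow_le {s t C : ℝ}
    (h : ∀ n : ℕ, n ≠ 0 → (n : ℝ) ^ s ≤ C * (n : ℝ) ^ t) : s ≤ t := by
  by_contra! hlt
  have htend := (tendsto_rpow_atTop (sub_pos.2 hlt)).comp (tendsto_natCast_atTop_atTop (R := ℝ))
  obtain ⟨n, hnC, hn⟩ :=
    ((htend.eventually_gt_atTop C).and (Filter.eventually_gt_atTop 0)).exists
  have hpos : (0 : ℝ) < n := by exact_mod_cast hn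
  refine hnC.not_ge ?_
  simpa [Real.rpow_sub hpos, div_le_iff₀ (Real.rpow_pos_of_pos hpos t)] using h n hn.ne'

/-- **Sharp generalized Bohnenblust–Hille inequality, necessity.**
If `m ≥ 1`, `q₁, …, q_m ∈ [1,2]` and there is a constant `C ≥ 1` such that the iterated mixed
norm of `(A(e_{i₁}, …, e_{i_m}))` is at most `C‖A‖` for every continuous `m`-linear form
`A : c₀ × ⋯ × c₀ → ℂ`, then `1/q₁ + ⋯ + 1/q_m ≤ (m+1)/2`. -/
theorem generalized_BH_necessity (m : ℕ) (hm : 1 ≤ m)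
    (q : Fin m → ℝ) (hq : ∀ i, 1 ≤ q i ∧ q i ≤ 2)
    (C : ℝ) (hC : 1 ≤ C)
    (h : ∀ A : ContinuousMultilinearMap ℂ (fun _ : Fin m => ZeroAtInftyContinuousMap ℕ ℂ) ℂ,
        mixedNorm m q (fun is => (‖A (fun k => unitVec ℂ (is k))‖₊ : ℝ≥0∞)) ≤
          ENNReal.ofReal (C * ‖A‖)) :
    ∑ i, 1 / q i ≤ (m + 1) / 2 := by
  refine le_of_forall_natCast_rpow_le (C := C) fun n hn => ?_
  have hω := Complex.isPrimitiveRoot_exp n hn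
  set ω := Complex.exp (2 * Real.pi * Complex.I / n)
  have hlow := (rpow_sum_le_mixedNorm n hn m q (fun i => by linarith [hq i]) _ fun is his => by
    rw [norm_sum_fourierForm_unitVec hn (hω.norm'_eq_one hn) is his, ENNReal.coe_one]).trans
      (h (∑ j ∈ Finset.range n, fourierForm ω n m j))
  rw [← ENNReal.ofReal_natCast,
    ENNReal.ofReal_rpow_of_pos (by exact_mod_cast Nat.pos_of_ne_zero hn),
    ENNReal.ofReal_le_ofReal_iff (by positivity)] at hlow
  refine hlow.trans ?_
  gcongr
  exact norm_sum_fourierForm_le hn hω m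
end

section
/- Let m ≥ 1, 1 ≤ s ≤ q ≤ 2, and p = (p_1,…,p_m) ∈ [1,∞]^m with 1/s − 1/q − |1/p| ≥ 0, and set λ = 1/(1/2 + 1/s − 1/q − |1/p|). Let q_1,…,q_m ∈ [λ,2]. If there is a constant C ≥ 1 such that for every continuous m-linear map A : X_{p_1} × ⋯ × X_{p_m} → ℓ_s (complex scalars) one has ( Σ_{i_1} ( Σ_{i_2} ( … ( Σ_{i_m} ‖A(e_{i_1},…,e_{i_m})‖_{ℓ_q}^{q_m} )^{q_{m-1}/q_m} ⋯ )^{q_2/q_3} )^{q_1/q_2} )^{1/q_1} ≤ C‖A‖, then necessarily 1/q_1 + ⋯ + 1/q_m ≤ m/2 + 1/s − 1/q − |1/p|. -/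
open scoped ENNReal NNReal

/-- The `ℓ_q`-norm (computed in `ℝ≥0∞`) of a complex sequence. -/
noncomputable def lqNorm (q : ℝ) (x : ℕ → ℂ) : ℝ≥0∞ :=
  (∑' n : ℕ, (‖x n‖₊ : ℝ≥0∞) ^ q) ^ (1 / q)

/-- A normed space over `ℂ` together with a distinguished sequence of "unit vectors". -/
structure SeqBanach where
  carrier : Type
  [nag : NormedAddCommGroup carrier]
  [ns : NormedSpace ℂ carrier]
  basis : ℕ → carrier

attribute [instance] SeqBanach.nag SeqBanach.ns

/-- `X_p`: the space `ℓ_p` of `p`-summable complex sequences for `p < ∞`, and `c₀` for `p = ∞`,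
together with its canonical unit vectors `e_i`. -/
noncomputable def Xsp (p : ℝ≥0∞) [Fact (1 ≤ p)] : SeqBanach :=
  if p = ∞ then
    { carrier := ZeroAtInftyContinuousMap ℕ ℂ
      basis := fun i =>
        { toFun := fun j => if j = i then 1 else 0
          continuous_toFun := continuous_of_discreteTopology
          zero_at_infty' := by
            rw [Filter.cocompact_eq_cofinite]
            refine Filter.Tendsto.congr' ?_ tendsto_const_nhds
            filter_upwards [Filter.eventually_cofinite_ne i] with j hj
            simp [hj] } }
  else
    { carrier := lp (fun _ : ℕ => ℂ) p
      basis := fun i => lp.single p i 1 }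

theorem exists_signs_abs_sum_le {ι τ : Type*} [Fintype ι] [DecidableEq ι] (T : Finset τ)
    (c : τ → ι → ℝ) (hc : ∀ t ∈ T, ∑ i, c t i ^ 2 ≤ 1) {L : ℝ} (hL : 0 < L)
    (hT : 2 * (T.card : ℝ) ≤ Real.exp L) :
    ∃ ε : ι → ℝ, (∀ i, |ε i| = 1) ∧ ∀ t ∈ T, |∑ i, ε i * c t i| ≤ 2 * √L := by
  set r := √L
  have hr0 : 0 < r := Real.sqrt_pos.2 hL
  have hrL : r * r = L := Real.mul_self_sqrt hL.le
  set E : Finset (ι → ℝ) := Fintype.piFinset (fun _ => {1, -1}) with hE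
  have hne : ((1 : ℝ)) ≠ -1 := by norm_num
  have hcard : (E.card : ℝ) = ∏ _i : ι, (2 : ℝ) := by
    rw [hE, Fintype.card_piFinset]
    simp [Finset.card_pair hne]
  have key (u : ℝ) (d : ι → ℝ) (hd : ∑ i, d i ^ 2 ≤ 1) :
      ∑ ε ∈ E, Real.exp (u * ∑ i, ε i * d i) ≤ E.card * Real.exp (u ^ 2 / 2) := by
    calc ∑ ε ∈ E, Real.exp (u * ∑ i, ε i * d i)
        = ∑ ε ∈ E, ∏ i, Real.exp (u * (ε i * d i)) := by
          simp only [Finset.mul_sum, Real.exp_sum]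
      _ = ∏ i, ∑ e ∈ ({1, -1} : Finset ℝ), Real.exp (u * (e * d i)) :=
          (Finset.prod_univ_sum (fun _ => ({1, -1} : Finset ℝ))
            (fun i e => Real.exp (u * (e * d i)))).symm
      _ ≤ ∏ i, (2 * Real.exp ((u * d i) ^ 2 / 2)) := by
          refine Finset.prod_le_prod (fun i _ => Finset.sum_nonneg fun _ _ => (Real.exp_pos _).le)
            fun i _ => ?_
          rw [Finset.sum_pair hne]
          have := Real.cosh_le_exp_half_sq (u * d i)
          rw [Real.cosh_eq] at this
          have h2 : u * (-1 * d i) = -(u * d i) := by ring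
          rw [one_mul, h2]
          linarith
      _ = E.card * Real.exp (u ^ 2 / 2 * ∑ i, d i ^ 2) := by
          rw [Finset.prod_mul_distrib, ← Real.exp_sum, hcard, Finset.mul_sum]
          congr 3 with i
          ring
      _ ≤ E.card * Real.exp (u ^ 2 / 2) := by
          gcongr
          nlinarith [sq_nonneg u]
  obtain ⟨ε, hεE, hε⟩ := Finset.exists_le_of_sum_le (s := E)
    (f := fun ε => ∑ t ∈ T, (Real.exp (r * ∑ i, ε i * c t i) + Real.exp (-r * ∑ i, ε i * c t i)))
    (g := fun _ => 2 * T.card * Real.exp (r ^ 2 / 2))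
    (by exact Fintype.piFinset_nonempty.2 fun _ => ⟨1, by simp⟩)
    (by
      rw [Finset.sum_comm, Finset.sum_const, nsmul_eq_mul]
      calc _ ≤ ∑ t ∈ T, (2 * (E.card * Real.exp (r ^ 2 / 2))) := by
            refine Finset.sum_le_sum fun t ht => ?_
            rw [Finset.sum_add_distrib]
            have h1 := key r (c t) (hc t ht)
            have h2 := key (-r) (c t) (hc t ht)
            rw [neg_sq] at h2
            linarith
        _ = _ := by rw [Finset.sum_const, nsmul_eq_mul]; ring)
  refine ⟨ε, fun i => ?_, fun t ht => ?_⟩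
  · have := Fintype.mem_piFinset.1 hεE i
    simp only [Finset.mem_insert, Finset.mem_singleton] at this
    rcases this with h | h <;> simp [h]
  · have h1 := (Finset.single_le_sum (f := fun t => Real.exp (r * ∑ i, ε i * c t i) +
      Real.exp (-r * ∑ i, ε i * c t i)) (fun _ _ => by positivity) ht).trans hε
    have h2 : 2 * (T.card : ℝ) * Real.exp (r ^ 2 / 2) ≤ Real.exp (L + r ^ 2 / 2) := by
      rw [Real.exp_add]; gcongr
    have h3 : Real.exp (r * |∑ i, ε i * c t i|) ≤ Real.exp (L + r ^ 2 / 2) := by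
      refine le_trans ?_ (h1.trans h2)
      rcases abs_choice (∑ i, ε i * c t i) with h | h <;> rw [h]
      · simp [(Real.exp_pos _).le]
      · simp [(Real.exp_pos _).le]
    have h4 := Real.exp_le_exp.1 h3
    nlinarith

theorem exists_signs_norm_sum_le {ι τ : Type*} [Fintype ι] [DecidableEq ι] (T : Finset τ)
    (c : τ → ι → ℂ) (hc : ∀ t ∈ T, ∑ i, ‖c t i‖ ^ 2 ≤ 1) {L : ℝ} (hL : 0 < L)
    (hT : 4 * (T.card : ℝ) ≤ Real.exp L) :
    ∃ ε : ι → ℝ, (∀ i, |ε i| = 1) ∧ ∀ t ∈ T, ‖∑ i, (ε i : ℂ) * c t i‖ ≤ 4 * √L := by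
  obtain ⟨ε, h1, h2⟩ := exists_signs_abs_sum_le (T ×ˢ (Finset.univ : Finset Bool))
    (fun t i => if t.2 then (c t.1 i).re else (c t.1 i).im)
    (by
      rintro ⟨t, b⟩ ht
      refine le_trans (Finset.sum_le_sum fun i _ => ?_) (hc t (Finset.mem_product.1 ht).1)
      cases b
      · simpa using sq_le_sq' (by linarith [neg_abs_le (c t i).im, Complex.abs_im_le_norm (c t i)])
          (Complex.im_le_norm (c t i))
      · simpa using sq_le_sq' (by linarith [neg_abs_le (c t i).re, Complex.abs_re_le_norm (c t i)])
          (Complex.re_le_norm (c t i)))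
    hL (by simp only [Finset.card_product, Finset.card_univ, Fintype.card_bool]; push_cast; linarith)
  refine ⟨ε, h1, fun t ht => ?_⟩
  have hre := h2 (t, true) (by simp [ht])
  have him := h2 (t, false) (by simp [ht])
  refine (Complex.norm_le_abs_re_add_abs_im _).trans ?_
  simp only [if_true, Bool.false_eq_true, if_false] at hre him
  simp only [Complex.re_sum, Complex.im_sum, Complex.re_ofReal_mul, Complex.im_ofReal_mul]
  linarith

theorem exists_int_div_approx {N : ℕ} (hN : 0 < N) (r : ℝ) :
    ∃ z : ℤ, |(z : ℝ) / N| ≤ |r| ∧ |r - z / N| ≤ 1 / N := by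
  have hN' : (0 : ℝ) < N := by exact_mod_cast hN
  have key : ∀ r : ℝ, 0 ≤ r → ∃ z : ℤ, |(z : ℝ) / N| ≤ |r| ∧ |r - z / N| ≤ 1 / N := by
    intro r hr
    have h0 : (0 : ℝ) ≤ ⌊r * N⌋ := by exact_mod_cast Int.floor_nonneg.2 (by positivity)
    have h1 := Int.floor_le (r * N)
    have h2 := Int.lt_floor_add_one (r * N)
    have h3 : (⌊r * N⌋ : ℝ) / N ≤ r := by rwa [div_le_iff₀ hN']
    refine ⟨⌊r * N⌋, ?_, ?_⟩
    · rw [abs_of_nonneg hr, abs_of_nonneg (by positivity)]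
      exact h3
    · rw [abs_of_nonneg (by linarith), sub_le_iff_le_add, ← add_div, le_div_iff₀ hN']
      linarith
  rcases le_total 0 r with h | h
  · exact key r h
  · obtain ⟨z, h1, h2⟩ := key (-r) (by linarith)
    refine ⟨-z, ?_, ?_⟩
    · push_cast
      rwa [neg_div, abs_neg, ← abs_neg r]
    · push_cast
      rw [← abs_neg]
      convert h2 using 2
      ring

theorem Complex.exists_finset_grid {N : ℕ} (hN : 0 < N) :
    ∃ G : Finset ℂ, G.card ≤ (2 * N + 1) ^ 2 ∧
      ∀ z : ℂ, ‖z‖ ≤ 1 → ∃ w ∈ G, ‖w‖ ≤ ‖z‖ ∧ ‖z - w‖ ≤ 2 / N := by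
  have hN' : (0 : ℝ) < N := by exact_mod_cast hN
  refine ⟨(Finset.Icc (-N : ℤ) N ×ˢ Finset.Icc (-N : ℤ) N).image
    fun a => ⟨(a.1 : ℝ) / N, (a.2 : ℝ) / N⟩, Finset.card_image_le.trans ?_, fun z hz => ?_⟩
  · rw [Finset.card_product, Int.card_Icc, sq]
    apply le_of_eq
    congr 1 <;> omega
  · obtain ⟨a, ha1, ha2⟩ := exists_int_div_approx hN z.re
    obtain ⟨b, hb1, hb2⟩ := exists_int_div_approx hN z.im
    have mem : ∀ (c : ℤ) (r : ℝ), |r| ≤ 1 → |(c : ℝ) / N| ≤ |r| → c ∈ Finset.Icc (-N : ℤ) N := by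
      intro c r hr hc
      have := hc.trans hr
      rw [abs_div, abs_of_pos hN', div_le_one hN'] at this
      rw [Finset.mem_Icc, ← abs_le]
      exact_mod_cast this
    refine ⟨⟨(a : ℝ) / N, (b : ℝ) / N⟩, Finset.mem_image.2 ⟨(a, b), Finset.mem_product.2
      ⟨mem a _ ((Complex.abs_re_le_norm z).trans hz) ha1,
        mem b _ ((Complex.abs_im_le_norm z).trans hz) hb1⟩, rfl⟩, ?_, ?_⟩
    · rw [Complex.norm_eq_sqrt_sq_add_sq, Complex.norm_eq_sqrt_sq_add_sq]
      exact Real.sqrt_le_sqrt (add_le_add (sq_le_sq.2 ha1) (sq_le_sq.2 hb1))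
    · refine (Complex.norm_le_abs_re_add_abs_im _).trans ?_
      simp only [Complex.sub_re, Complex.sub_im]
      have : (2 : ℝ) / N = 1 / N + 1 / N := by ring
      linarith

theorem norm_prod_sub_prod_le_card_mul {κ : Type*} [Fintype κ] {x y : κ → ℂ}
    (hx : ∀ k, ‖x k‖ ≤ 1) (hy : ∀ k, ‖y k‖ ≤ 1) {η : ℝ} (hη : 0 ≤ η)
    (hxy : ∀ k, ‖x k - y k‖ ≤ η) :
    ‖∏ k, x k - ∏ k, y k‖ ≤ Fintype.card κ * η := by
  have h := (ContinuousMultilinearMap.mkPiAlgebra ℂ κ ℂ).norm_image_sub_le x y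
  simp only [ContinuousMultilinearMap.mkPiAlgebra_apply,
    ContinuousMultilinearMap.norm_mkPiAlgebra, one_mul] at h
  refine h.trans ?_
  have h1 : max ‖x‖ ‖y‖ ≤ 1 := max_le ((pi_norm_le_iff_of_nonneg zero_le_one).2 hx)
    ((pi_norm_le_iff_of_nonneg zero_le_one).2 hy)
  have h2 : ‖x - y‖ ≤ η := (pi_norm_le_iff_of_nonneg hη).2 hxy
  calc (Fintype.card κ : ℝ) * max ‖x‖ ‖y‖ ^ (Fintype.card κ - 1) * ‖x - y‖
      ≤ Fintype.card κ * 1 * η := by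
        gcongr
        exact pow_le_one₀ (le_max_of_le_left (norm_nonneg _)) h1
    _ = _ := by ring

theorem sum_norm_prod_sq {κ : Type*} [Fintype κ] [DecidableEq κ] {n : ℕ} (x : κ → Fin n → ℂ) :
    ∑ i : κ → Fin n, ‖∏ k, x k (i k)‖ ^ 2 = ∏ k, ∑ j, ‖x k j‖ ^ 2 := by
  rw [Finset.prod_univ_sum, Fintype.piFinset_univ]
  simp only [norm_prod, Finset.prod_pow]

theorem exists_signs_tensor_of_norm_le_one (κ : Type*) [Fintype κ] [DecidableEq κ] {δ : ℝ}
    (hδ : 0 < δ) :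
    ∃ K : ℝ, 0 < K ∧ ∀ n : ℕ, 1 ≤ n → ∃ ε : (κ → Fin n) → ℝ, (∀ i, |ε i| = 1) ∧
      ∀ x : κ → Fin n → ℂ, (∀ k, ∑ j, ‖x k j‖ ^ 2 ≤ 1) →
        ‖∑ i, (ε i : ℂ) * ∏ k, x k (i k)‖ ≤ K * (n : ℝ) ^ (1 / 2 + δ) := by
  set d := Fintype.card κ with hd
  set K₀ : ℝ := 2 + d * (3 + d / δ) with hK₀
  have hK₀pos : 0 < K₀ := by positivity
  refine ⟨4 * √K₀ + 2 * d, by positivity, fun n hn => ?_⟩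
  have hn1 : (1 : ℝ) ≤ n := by exact_mod_cast hn
  have hn0 : (0 : ℝ) < n := by linarith
  have hN : 0 < n ^ d := pow_pos (by omega) d
  obtain ⟨G, hGcard, hG⟩ := Complex.exists_finset_grid hN
  set T : Finset (κ → Fin n → ℂ) := (Fintype.piFinset fun _ => Fintype.piFinset fun _ => G).filter
    fun v => ∀ k, ∑ j, ‖v k j‖ ^ 2 ≤ 1 with hT
  have hTcard : (T.card : ℝ) ≤ ((9 * (n : ℝ) ^ (2 * d)) ^ n) ^ d := by
    have h1 : T.card ≤ (((2 * n ^ d + 1) ^ 2) ^ n) ^ d := by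
      refine (Finset.card_filter_le _ _).trans ?_
      simp only [Fintype.card_piFinset, Finset.prod_const, Finset.card_univ, Fintype.card_fin]
      gcongr
    have h2 : ((2 * n ^ d + 1) ^ 2 : ℝ) ≤ 9 * (n : ℝ) ^ (2 * d) := by
      have : (1 : ℝ) ≤ (n : ℝ) ^ d := one_le_pow₀ hn1
      rw [mul_comm 2 d, pow_mul]
      nlinarith
    calc (T.card : ℝ) ≤ (((2 * n ^ d + 1) ^ 2 : ℝ) ^ n) ^ d := by exact_mod_cast h1
      _ ≤ _ := by gcongr
  set L : ℝ := K₀ * (n : ℝ) ^ (1 + 2 * δ) with hL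
  have hLpos : 0 < L := by positivity
  have hexp : 4 * (T.card : ℝ) ≤ Real.exp L := by
    refine (mul_le_mul_of_nonneg_left hTcard (by norm_num)).trans ?_
    rw [← Real.log_le_iff_le_exp (by positivity), Real.log_mul (by norm_num) (by positivity),
      Real.log_pow, Real.log_pow, Real.log_mul (by norm_num) (by positivity), Real.log_pow]
    have h4 : Real.log 4 ≤ 2 := by
      rw [show (4 : ℝ) = 2 ^ 2 by norm_num, Real.log_pow]
      have := Real.log_two_lt_d9
      push_cast
      linarith
    have h9 : Real.log 9 ≤ 3 := by
      rw [Real.log_le_iff_le_exp (by norm_num)]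
      have := Real.exp_one_gt_d9
      calc (9 : ℝ) ≤ 2.7 ^ 3 := by norm_num
        _ ≤ Real.exp 1 ^ 3 := by gcongr; linarith
        _ = Real.exp 3 := by rw [← Real.exp_nat_mul]; norm_num
    have hlog := Real.log_le_rpow_div hn0.le (show 0 < 2 * δ by positivity)
    have hone : (1 : ℝ) ≤ (n : ℝ) ^ (2 * δ) := Real.one_le_rpow hn1 (by positivity)
    have hA : (n : ℝ) ^ (1 + 2 * δ) = n * (n : ℝ) ^ (2 * δ) := by
      rw [Real.rpow_add hn0, Real.rpow_one]
    set P := (n : ℝ) ^ (2 * δ)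
    rw [hL, hA]
    push_cast
    calc Real.log 4 + d * (n * (Real.log 9 + 2 * d * Real.log n))
        ≤ 2 * (n * P) + d * (n * (3 * P + 2 * d * (P / (2 * δ)))) := by
          gcongr
          · nlinarith
          · nlinarith
      _ = K₀ * (n * P) := by
          rw [hK₀]
          field_simp
  obtain ⟨ε, hε1, hε⟩ := exists_signs_norm_sum_le T (fun v (i : κ → Fin n) => ∏ k, v k (i k))
    (fun v hv => by
      rw [sum_norm_prod_sq]
      exact Finset.prod_le_one (fun k _ => by positivity) fun k _ => (Finset.mem_filter.1 hv).2 k)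
    hLpos hexp
  refine ⟨ε, hε1, fun x hx => ?_⟩
  have hx1 : ∀ k j, ‖x k j‖ ≤ 1 := fun k j => by
    have := (Finset.single_le_sum (f := fun j => ‖x k j‖ ^ 2) (fun _ _ => by positivity)
      (Finset.mem_univ j)).trans (hx k)
    exact (sq_le_one_iff₀ (norm_nonneg _)).1 this
  choose v hvG hvx hxv using fun k j => hG (x k j) (hx1 k j)
  have hvT : v ∈ T := Finset.mem_filter.2 ⟨Fintype.mem_piFinset.2 fun k =>
    Fintype.mem_piFinset.2 fun j => hvG k j, fun k => le_trans (by gcongr; exact hvx _ _) (hx k)⟩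
  have herr : ‖∑ i, (ε i : ℂ) * ∏ k, x k (i k) - ∑ i, (ε i : ℂ) * ∏ k, v k (i k)‖ ≤ 2 * d := by
    rw [← Finset.sum_sub_distrib]
    calc _ ≤ ∑ i : κ → Fin n, (d * (2 / (n ^ d : ℕ)) : ℝ) := by
          refine norm_sum_le_of_le _ fun i _ => ?_
          rw [← mul_sub, norm_mul, Complex.norm_real, Real.norm_eq_abs, hε1, one_mul]
          exact norm_prod_sub_prod_le_card_mul (fun k => hx1 _ _)
            (fun k => (hvx _ _).trans (hx1 _ _)) (by positivity) fun k => hxv _ _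
      _ = 2 * d := by
          rw [Finset.sum_const, Finset.card_univ, Fintype.card_fun, Fintype.card_fin, nsmul_eq_mul]
          have : ((n ^ d : ℕ) : ℝ) ≠ 0 := by positivity
          rw [← hd]
          field_simp
  have hsqrt : √L = √K₀ * (n : ℝ) ^ (1 / 2 + δ) := by
    rw [hL, Real.sqrt_mul hK₀pos.le, Real.sqrt_eq_rpow ((n : ℝ) ^ _), ← Real.rpow_mul hn0.le]
    congr 2
    ring
  have hone : (1 : ℝ) ≤ (n : ℝ) ^ (1 / 2 + δ) := Real.one_le_rpow hn1 (by positivity)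
  have hv := hε v hvT
  have htri := norm_le_norm_add_norm_sub' (∑ i, (ε i : ℂ) * ∏ k, x k (i k))
    (∑ i, (ε i : ℂ) * ∏ k, v k (i k))
  rw [hsqrt] at hv
  have hd0 : (0 : ℝ) ≤ d := by positivity
  nlinarith

theorem exists_signs_tensor (κ : Type*) [Fintype κ] [DecidableEq κ] {δ : ℝ} (hδ : 0 < δ) :
    ∃ K : ℝ, 0 < K ∧ ∀ n : ℕ, 1 ≤ n → ∃ ε : (κ → Fin n) → ℝ, (∀ i, |ε i| = 1) ∧
      ∀ x : κ → Fin n → ℂ,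
        ‖∑ i, (ε i : ℂ) * ∏ k, x k (i k)‖ ≤
          K * (n : ℝ) ^ (1 / 2 + δ) * ∏ k, √(∑ j, ‖x k j‖ ^ 2) := by
  obtain ⟨K, hK, h⟩ := exists_signs_tensor_of_norm_le_one κ hδ
  refine ⟨K, hK, fun n hn => ?_⟩
  obtain ⟨ε, hε1, hε⟩ := h n hn
  refine ⟨ε, hε1, fun x => ?_⟩
  set R : κ → ℝ := fun k => √(∑ j, ‖x k j‖ ^ 2) with hR
  have hR0 : ∀ k, 0 ≤ R k := fun k => Real.sqrt_nonneg _
  have hRsq : ∀ k, R k ^ 2 = ∑ j, ‖x k j‖ ^ 2 := fun k => Real.sq_sqrt (by positivity)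
  have hx : ∀ k j, x k j = R k * ((R k : ℂ)⁻¹ * x k j) := fun k j => by
    rcases eq_or_ne (R k) 0 with h0 | h0
    · have h1 := hRsq k
      rw [h0, zero_pow two_ne_zero, eq_comm,
        Finset.sum_eq_zero_iff_of_nonneg fun _ _ => by positivity] at h1
      have h2 : x k j = 0 := by simpa using h1 j (Finset.mem_univ j)
      simp [h2]
    · have : (R k : ℂ) ≠ 0 := by exact_mod_cast h0
      rw [mul_inv_cancel_left₀ this]
  have key := hε (fun k j => (R k : ℂ)⁻¹ * x k j) fun k => by
    simp only [norm_mul, norm_inv, Complex.norm_real, Real.norm_eq_abs, abs_of_nonneg (hR0 k),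
      mul_pow]
    rw [← Finset.mul_sum, ← hRsq, ← mul_pow]
    exact pow_le_one₀ (mul_nonneg (inv_nonneg.2 (hR0 k)) (hR0 k)) inv_mul_le_one
  have hsum : ∑ i, (ε i : ℂ) * ∏ k, x k (i k) =
      (∏ k, (R k : ℂ)) * ∑ i, (ε i : ℂ) * ∏ k, ((R k : ℂ)⁻¹ * x k (i k)) := by
    rw [Finset.mul_sum]
    refine Finset.sum_congr rfl fun i _ => ?_
    rw [mul_left_comm, ← Finset.prod_mul_distrib]
    congr 1
    exact Finset.prod_congr rfl fun k _ => hx k (i k)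
  have hnorm : ‖∏ k, (R k : ℂ)‖ = ∏ k, R k := by
    rw [norm_prod]
    exact Finset.prod_congr rfl fun k _ => by
      rw [Complex.norm_real, Real.norm_eq_abs, abs_of_nonneg (hR0 k)]
  rw [hsum, norm_mul, hnorm, mul_comm]
  exact mul_le_mul_of_nonneg_right key (Finset.prod_nonneg fun k _ => hR0 k)

/-- Signs whose associated `m`-linear map into `ℓ_2^n` has small norm. -/
theorem exists_signs_multilinear (m : ℕ) {δ : ℝ} (hδ : 0 < δ) :
    ∃ K : ℝ, 0 < K ∧ ∀ n : ℕ, 1 ≤ n → ∃ ε : (Fin m → Fin n) → Fin n → ℝ, (∀ i j, |ε i j| = 1) ∧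
      ∀ x : Fin m → Fin n → ℂ,
        √(∑ j, ‖∑ i, (∏ k, x k (i k)) * (ε i j : ℂ)‖ ^ 2) ≤
          K * (n : ℝ) ^ (1 / 2 + δ) * ∏ k, √(∑ j, ‖x k j‖ ^ 2) := by
  obtain ⟨K, hK, h⟩ := exists_signs_tensor (Fin (m + 1)) hδ
  refine ⟨K, hK, fun n hn => ?_⟩
  obtain ⟨ε, hε1, hε⟩ := h n hn
  refine ⟨fun i j => ε (Fin.cons j i), fun i j => hε1 _, fun x => ?_⟩
  obtain ⟨z, hz⟩ : ∃ z : Fin n → ℂ, ∀ j, ∑ i, (∏ k, x k (i k)) * (ε (Fin.cons j i) : ℂ) = z j :=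
    ⟨_, fun _ => rfl⟩
  simp only [hz]
  have key := hε (Fin.cons (fun j => (starRingEnd ℂ) (z j)) x)
  have hsum : ∑ i, (ε i : ℂ) * ∏ k, (Fin.cons (fun j => (starRingEnd ℂ) (z j)) x :
      Fin (m + 1) → Fin n → ℂ) k (i k) = ((∑ j, ‖z j‖ ^ 2 : ℝ) : ℂ) := by
    rw [← (Fin.consEquiv fun _ => Fin n).sum_comp, Fintype.sum_prod_type, Complex.ofReal_sum]
    refine Finset.sum_congr rfl fun j _ => ?_
    rw [Complex.ofReal_pow, ← Complex.conj_mul']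
    refine Eq.trans ?_ (congrArg ((starRingEnd ℂ) (z j) * ·) (hz j))
    rw [Finset.mul_sum]
    refine Finset.sum_congr rfl fun i _ => ?_
    rw [show (Fin.consEquiv fun _ => Fin n) (j, i) = Fin.cons j i from rfl, Fin.prod_univ_succ]
    simp only [Fin.cons_zero, Fin.cons_succ]
    ring
  rw [hsum, Fin.prod_univ_succ, Complex.norm_real, Real.norm_eq_abs,
    abs_of_nonneg (by positivity)] at key
  simp only [Fin.cons_zero, Fin.cons_succ, RCLike.norm_conj] at key
  have hS : 0 ≤ ∑ j, ‖z j‖ ^ 2 := by positivity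
  generalize ∑ j, ‖z j‖ ^ 2 = S at key hS
  rcases hS.eq_or_lt with h0 | h0
  · rw [← h0, Real.sqrt_zero]
    positivity
  · have h1 : 0 < √S := Real.sqrt_pos.2 h0
    have h2 : √S * √S = S := Real.mul_self_sqrt hS
    refine le_of_mul_le_mul_right ?_ h1
    linarith

theorem rpow_sum_rpow_le_card_mul {n : ℕ} {r t : ℝ} (hr : 0 < r) (hrt : r ≤ t) {a : Fin n → ℝ}
    (ha : ∀ j, 0 ≤ a j) :
    (∑ j, a j ^ r) ^ (1 / r) ≤ (n : ℝ) ^ (1 / r - 1 / t) * (∑ j, a j ^ t) ^ (1 / t) := by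
  have ht : 0 < t := hr.trans_le hrt
  have h := Real.rpow_sum_le_const_mul_sum_rpow Finset.univ (fun j => a j ^ r)
    ((one_le_div hr).2 hrt)
  simp only [abs_of_nonneg (Real.rpow_nonneg (ha _) _), ← Real.rpow_mul (ha _),
    mul_div_cancel₀ t hr.ne', Finset.card_univ, Fintype.card_fin] at h
  have hS : 0 ≤ ∑ j, a j ^ r := Finset.sum_nonneg fun j _ => Real.rpow_nonneg (ha j) _
  have hS' : 0 ≤ ∑ j, a j ^ t := Finset.sum_nonneg fun j _ => Real.rpow_nonneg (ha j) _
  have h2 := Real.rpow_le_rpow (Real.rpow_nonneg hS _) h (one_div_nonneg.2 ht.le)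
  rw [← Real.rpow_mul hS, Real.mul_rpow (Real.rpow_nonneg n.cast_nonneg _) hS',
    ← Real.rpow_mul n.cast_nonneg] at h2
  convert h2 using 2
  · field_simp
  · congr 1
    field_simp

theorem Xsp.exists_coord (p : ℝ≥0∞) [Fact (1 ≤ p)] (hp : (p⁻¹).toReal ≤ 1 / 2) :
    ∃ φ : ℕ → (Xsp p).carrier →L[ℂ] ℂ,
      (∀ i j, φ i ((Xsp p).basis j) = if i = j then 1 else 0) ∧
      ∀ (n : ℕ) (x : (Xsp p).carrier),
        √(∑ j : Fin n, ‖φ j x‖ ^ 2) ≤ (n : ℝ) ^ (1 / 2 - (p⁻¹).toReal) * ‖x‖ := by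
  obtain ⟨S, hS⟩ : ∃ S, S = Xsp p := ⟨_, rfl⟩
  rw [← hS]
  unfold Xsp at hS
  split_ifs at hS with hp' <;> subst hS
  · have hle : ∀ (i : ℕ) (f : ZeroAtInftyContinuousMap ℕ ℂ), ‖f i‖ ≤ ‖f‖ := fun i f => by
      rw [← ZeroAtInftyContinuousMap.norm_toBCF_eq_norm]
      exact f.toBCF.norm_coe_le_norm i
    refine ⟨fun i => LinearMap.mkContinuous
      { toFun := fun f : ZeroAtInftyContinuousMap ℕ ℂ => f i
        map_add' := fun _ _ => rfl
        map_smul' := fun _ _ => rfl } 1 (fun f => by simpa using hle i f),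
      fun i j => rfl, fun n x => ?_⟩
    subst hp'
    simp only [ENNReal.inv_top, ENNReal.toReal_zero, sub_zero, ← Real.sqrt_eq_rpow]
    rw [← Real.sqrt_sq (norm_nonneg x), ← Real.sqrt_mul n.cast_nonneg]
    refine Real.sqrt_le_sqrt ?_
    calc ∑ j : Fin n, ‖x j‖ ^ 2 ≤ ∑ _j : Fin n, ‖x‖ ^ 2 := by
          gcongr with j
          exact hle j x
      _ = n * ‖x‖ ^ 2 := by simp
  · have hp1 : 1 ≤ p := Fact.out
    have hpos : 0 < p.toReal := ENNReal.toReal_pos (by rintro rfl; simp at hp1) hp'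
    rw [ENNReal.toReal_inv] at hp ⊢
    have hp2 : 2 ≤ p.toReal := by
      rw [inv_eq_one_div] at hp
      exact (one_div_le_one_div hpos two_pos).1 hp
    refine ⟨fun i => lp.evalCLM ℂ (fun _ : ℕ => ℂ) p i, fun i j => ?_, fun n x => ?_⟩
    · change (lp.single p j (1 : ℂ) : lp (fun _ : ℕ => ℂ) p) i = _
      rw [lp.single_apply, Pi.single_apply]
    · change √(∑ j : Fin n, ‖x j‖ ^ 2) ≤ _
      have h := rpow_sum_rpow_le_card_mul two_pos hp2 (a := fun j : Fin n => ‖x j‖)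
        fun _ => norm_nonneg _
      simp only [Real.rpow_two] at h
      rw [Real.sqrt_eq_rpow, ← one_div p.toReal]
      refine h.trans (mul_le_mul_of_nonneg_left ?_ (Real.rpow_nonneg n.cast_nonneg _))
      have h2 := lp.sum_rpow_le_norm_rpow hpos x (Finset.range n)
      rw [Finset.sum_range] at h2
      refine (Real.rpow_le_rpow (by positivity) h2 (by positivity)).trans_eq ?_
      rw [← Real.rpow_mul (norm_nonneg x), mul_one_div_cancel hpos.ne', Real.rpow_one]

theorem lp.exists_extend_zero (s : ℝ≥0∞) {n : ℕ} (z : Fin n → ℂ) :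
    ∃ w : lp (fun _ : ℕ => ℂ) s, ∀ l, w l = if h : l < n then z ⟨l, h⟩ else 0 := by
  refine ⟨⟨fun l => if h : l < n then z ⟨l, h⟩ else 0, Memℓp.of_exponent_ge
    (memℓp_zero ((Set.finite_lt_nat n).subset fun l hl => ?_)) zero_le⟩, fun l => rfl⟩
  by_contra h
  exact hl (dif_neg h)

theorem lp.norm_le_of_extend_zero (s : ℝ≥0∞) (hs1 : 1 ≤ s) (hs2 : s ≤ 2) {n : ℕ} (z : Fin n → ℂ)
    (w : lp (fun _ : ℕ => ℂ) s) (hw : ∀ l, w l = if h : l < n then z ⟨l, h⟩ else 0) :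
    ‖w‖ ≤ (n : ℝ) ^ ((s⁻¹).toReal - 1 / 2) * √(∑ j, ‖z j‖ ^ 2) := by
  have hpos : 0 < s.toReal := ENNReal.toReal_pos (by rintro rfl; simp at hs1)
    (ne_top_of_le_ne_top ENNReal.ofNat_ne_top hs2)
  have hs2' : s.toReal ≤ 2 := by
    simpa using ENNReal.toReal_mono ENNReal.ofNat_ne_top hs2
  have h := rpow_sum_rpow_le_card_mul hpos hs2' (a := fun j : Fin n => ‖z j‖)
    fun _ => norm_nonneg _
  simp only [Real.rpow_two] at h
  rw [Real.sqrt_eq_rpow, ENNReal.toReal_inv, ← one_div, lp.norm_eq_tsum_rpow hpos]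
  refine le_of_eq_of_le ?_ h
  rw [tsum_eq_sum (s := Finset.range n), Finset.sum_range]
  · simp [hw]
  · intro l hl
    have hwl : ‖w l‖ = 0 := norm_eq_zero.2 (by rw [hw, dif_neg (by simpa using hl)])
    rw [hwl, Real.zero_rpow hpos.ne']

theorem rpow_mul_le_mixedNorm (n : ℕ) (c : ℝ≥0∞) : ∀ (m : ℕ) (q : Fin m → ℝ)
    (a : (Fin m → ℕ) → ℝ≥0∞), (∀ i, 0 < q i) → (∀ is, (∀ k, is k < n) → c ≤ a is) →
    (n : ℝ≥0∞) ^ (∑ i, 1 / q i) * c ≤ mixedNorm m q a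
  | 0, q, a, _, ha => by simpa [mixedNorm] using ha _ (fun k => k.elim0)
  | m + 1, q, a, hq, ha => by
    rw [mixedNorm, Fin.sum_univ_succ]
    set e := ∑ i : Fin m, 1 / q i.succ
    have h0 := hq 0
    have hin : ∀ i ∈ Finset.range n, ((n : ℝ≥0∞) ^ e * c) ^ q 0 ≤
        mixedNorm m (fun j => q j.succ) (fun is => a (Fin.cons i is)) ^ q 0 := fun i hi =>
      ENNReal.rpow_le_rpow (rpow_mul_le_mixedNorm n c m _ _ (fun j => hq j.succ) fun is his =>
        ha _ fun k => by
          refine Fin.cases ?_ (fun k => ?_) k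
          · simpa using hi
          · simpa using his k) h0.le
    calc (n : ℝ≥0∞) ^ (1 / q 0 + e) * c = (n * ((n : ℝ≥0∞) ^ e * c) ^ q 0) ^ (1 / q 0) := by
          rw [ENNReal.rpow_add_of_nonneg _ _ (by positivity)
            (Finset.sum_nonneg fun i _ => (one_div_pos.2 (hq i.succ)).le),
            ENNReal.mul_rpow_of_nonneg _ _ (by positivity), ← ENNReal.rpow_mul,
            mul_one_div_cancel h0.ne', ENNReal.rpow_one, mul_assoc]
      _ = (∑ _i ∈ Finset.range n, ((n : ℝ≥0∞) ^ e * c) ^ q 0) ^ (1 / q 0) := by simp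
      _ ≤ _ := by
          refine ENNReal.rpow_le_rpow ?_ (by positivity)
          exact (Finset.sum_le_sum hin).trans (ENNReal.sum_le_tsum _)

theorem exists_continuousMultilinearMap_small_norm (m : ℕ) (s : ℝ≥0∞) [Fact (1 ≤ s)] (hs2 : s ≤ 2)
    (p : Fin m → ℝ≥0∞) [∀ k, Fact (1 ≤ p k)] (hp : ∀ k, ((p k)⁻¹).toReal ≤ 1 / 2)
    {δ : ℝ} (hδ : 0 < δ) :
    ∃ K : ℝ, 0 < K ∧ ∀ n : ℕ, 1 ≤ n →
      ∃ A : ContinuousMultilinearMap ℂ (fun k => (Xsp (p k)).carrier) (lp (fun _ : ℕ => ℂ) s),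
        ‖A‖ ≤ K * (n : ℝ) ^ (m / 2 + (s⁻¹).toReal - ∑ k, ((p k)⁻¹).toReal + δ) ∧
        ∀ is : Fin m → ℕ, (∀ k, is k < n) → ∀ l < n,
          ‖A (fun k => (Xsp (p k)).basis (is k)) l‖ = 1 := by
  obtain ⟨K, hK, hsigns⟩ := exists_signs_multilinear m hδ
  choose φ hφb hφn using fun k => Xsp.exists_coord (p k) (hp k)
  refine ⟨K, hK, fun n hn => ?_⟩
  have hn0 : (0 : ℝ) < n := by exact_mod_cast hn
  obtain ⟨ε, hε1, hε⟩ := hsigns n hn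
  choose w hw using fun i : Fin m → Fin n => lp.exists_extend_zero s fun j => (ε i j : ℂ)
  let A : ContinuousMultilinearMap ℂ (fun k => (Xsp (p k)).carrier) (lp (fun _ : ℕ => ℂ) s) :=
    ∑ i : Fin m → Fin n, ((ContinuousMultilinearMap.mkPiAlgebra ℂ (Fin m) ℂ).compContinuousLinearMap
      fun k => φ k (i k)).smulRight (w i)
  have hA : ∀ x l, A x l = if h : l < n then
      ∑ i : Fin m → Fin n, (∏ k, φ k (i k) (x k)) * (ε i ⟨l, h⟩ : ℂ) else 0 := fun x l => by
    have h1 : A x = ∑ i : Fin m → Fin n, (∏ k, φ k (i k) (x k)) • w i := by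
      simp [A]
    rw [h1, lp.coeFn_sum, Finset.sum_apply]
    split_ifs with h <;> simp [hw, h]
  refine ⟨A, ?_, fun is his l hl => ?_⟩
  · refine ContinuousMultilinearMap.opNorm_le_bound (by positivity) fun x => ?_
    refine (lp.norm_le_of_extend_zero s Fact.out hs2
      (fun j => ∑ i : Fin m → Fin n, (∏ k, φ k (i k) (x k)) * (ε i j : ℂ)) (A x) (hA x)).trans ?_
    have h1 : ∏ k, √(∑ j : Fin n, ‖φ k j (x k)‖ ^ 2) ≤
        (n : ℝ) ^ (∑ k, (1 / 2 - ((p k)⁻¹).toReal)) * ∏ k, ‖x k‖ := by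
      rw [Real.rpow_sum_of_pos hn0, ← Finset.prod_mul_distrib]
      exact Finset.prod_le_prod (fun _ _ => Real.sqrt_nonneg _) fun k _ => hφn k n (x k)
    calc _ ≤ (n : ℝ) ^ ((s⁻¹).toReal - 1 / 2) * (K * (n : ℝ) ^ (1 / 2 + δ) *
          ((n : ℝ) ^ (∑ k, (1 / 2 - ((p k)⁻¹).toReal)) * ∏ k, ‖x k‖)) := by
          gcongr
          exact (hε fun k j => φ k j (x k)).trans (by gcongr)
      _ = K * ((n : ℝ) ^ ((s⁻¹).toReal - 1 / 2) * (n : ℝ) ^ (1 / 2 + δ) *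
          (n : ℝ) ^ (∑ k, (1 / 2 - ((p k)⁻¹).toReal))) * ∏ k, ‖x k‖ := by ring
      _ = _ := by
          rw [← Real.rpow_add hn0, ← Real.rpow_add hn0, Finset.sum_sub_distrib, Finset.sum_const,
            Finset.card_univ, Fintype.card_fin, nsmul_eq_mul]
          congr 3
          ring
  · rw [hA, dif_pos hl, Fintype.sum_eq_single fun k => (⟨is k, his k⟩ : Fin n)]
    · simp [hφb, hε1]
    · intro i hi
      obtain ⟨k, hk⟩ := Function.ne_iff.1 hi
      rw [Finset.prod_eq_zero (Finset.mem_univ k), zero_mul]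
      rw [hφb, if_neg]
      exact fun h => hk (Fin.ext h)

theorem le_of_forall_natCast_rpow_le_s3 {a b K : ℝ}
    (h : ∀ n : ℕ, 1 ≤ n → (n : ℝ) ^ a ≤ K * (n : ℝ) ^ b) : a ≤ b := by
  by_contra! hab
  have ht : Filter.Tendsto (fun n : ℕ => (n : ℝ) ^ (a - b)) Filter.atTop Filter.atTop :=
    (tendsto_rpow_atTop (sub_pos.2 hab)).comp tendsto_natCast_atTop_atTop
  obtain ⟨n, hn, hn1⟩ := ((ht.eventually_gt_atTop K).and (Filter.eventually_ge_atTop 1)).exists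
  have hn0 : (0 : ℝ) < n := by exact_mod_cast hn1
  rw [Real.rpow_sub hn0, lt_div_iff₀ (by positivity)] at hn
  exact (h n hn1).not_gt hn

/-- **Main theorem, necessity (Theorem 2, (1) ⟹ (2)).**
Let `m ≥ 1`, `1 ≤ s ≤ q ≤ 2`, `p ∈ [1,∞]^m` with `1/s - 1/q - |1/p| ≥ 0`,
`λ = 1/(1/2 + 1/s - 1/q - |1/p|)` and `q₁, …, q_m ∈ [λ,2]`. If there is `C ≥ 1` such that the
iterated mixed norm with exponents `(q₁, …, q_m)` of `(‖A(e_{i₁}, …, e_{i_m})‖_{ℓ_q})` is at most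
`C‖A‖` for every continuous `m`-linear `A : X_{p₁} × ⋯ × X_{p_m} → ℓ_s`, then necessarily
`1/q₁ + ⋯ + 1/q_m ≤ m/2 + 1/s - 1/q - |1/p|`. -/
theorem main_theorem_necessity (m : ℕ) (hm : 1 ≤ m)
    (s q : ℝ≥0∞) [Fact (1 ≤ s)] (hsq : s ≤ q) (hq2 : q ≤ 2)
    (p : Fin m → ℝ≥0∞) [∀ k, Fact (1 ≤ p k)]
    (hpos : 0 ≤ (s⁻¹).toReal - (q⁻¹).toReal - ∑ k, ((p k)⁻¹).toReal)
    (qq : Fin m → ℝ)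
    (hqq : ∀ i, 1 / (1 / 2 + (s⁻¹).toReal - (q⁻¹).toReal - ∑ k, ((p k)⁻¹).toReal) ≤ qq i ∧
      qq i ≤ 2)
    (C : ℝ) (hC : 1 ≤ C)
    (h : ∀ A : ContinuousMultilinearMap ℂ (fun k => (Xsp (p k)).carrier)
        (lp (fun _ : ℕ => ℂ) s),
        mixedNorm m qq
            (fun is => lqNorm q.toReal (fun j => (A (fun k => (Xsp (p k)).basis (is k))) j)) ≤
          ENNReal.ofReal (C * ‖A‖)) :
    ∑ i, 1 / qq i ≤ m / 2 + (s⁻¹).toReal - (q⁻¹).toReal - ∑ k, ((p k)⁻¹).toReal := by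
  have hs1 : 1 ≤ s := Fact.out
  have hq1 : 1 ≤ q := hs1.trans hsq
  have hqtop : q ≠ ∞ := ne_top_of_le_ne_top ENNReal.ofNat_ne_top hq2
  have hqpos : 0 < q.toReal := ENNReal.toReal_pos (by rintro rfl; simp at hq1) hqtop
  have hs_inv : (s⁻¹).toReal ≤ 1 := by
    simpa using ENNReal.toReal_mono ENNReal.one_ne_top (ENNReal.inv_le_one.2 hs1)
  have hq_inv : 1 / 2 ≤ (q⁻¹).toReal := by
    have : q.toReal ≤ 2 := by simpa using ENNReal.toReal_mono ENNReal.ofNat_ne_top hq2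
    rw [ENNReal.toReal_inv, ← one_div]
    exact one_div_le_one_div_of_le hqpos this
  have hp : ∀ k, ((p k)⁻¹).toReal ≤ 1 / 2 := fun k => by
    have := Finset.single_le_sum (f := fun k => ((p k)⁻¹).toReal)
      (fun _ _ => ENNReal.toReal_nonneg) (Finset.mem_univ k)
    linarith
  have hqq0 : ∀ i, 0 < qq i := fun i =>
    lt_of_lt_of_le (one_div_pos.2 (by linarith)) (hqq i).1
  refine le_of_forall_pos_le_add fun δ hδ => ?_
  obtain ⟨K, hK, hA⟩ := exists_continuousMultilinearMap_small_norm m s (hsq.trans hq2) p hp hδ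
  suffices hmain : ∑ i, 1 / qq i + 1 / q.toReal ≤
      m / 2 + (s⁻¹).toReal - ∑ k, ((p k)⁻¹).toReal + δ by
    rw [ENNReal.toReal_inv q, ← one_div q.toReal]
    linarith
  refine le_of_forall_natCast_rpow_le_s3 (K := C * K) fun n hn => ?_
  obtain ⟨A, hAn, hA1⟩ := hA n hn
  have hlow := rpow_mul_le_mixedNorm n ((n : ℝ≥0∞) ^ (1 / q.toReal)) m qq
    (fun is => lqNorm q.toReal (fun j => (A (fun k => (Xsp (p k)).basis (is k))) j)) hqq0
    fun is his => by
      refine ENNReal.rpow_le_rpow ?_ (by positivity)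
      refine le_trans (le_of_eq ?_) (ENNReal.sum_le_tsum (Finset.range n))
      have : ∀ j ∈ Finset.range n,
          ((‖A (fun k => (Xsp (p k)).basis (is k)) j‖₊ : ℝ≥0∞)) ^ q.toReal = 1 := fun j hj => by
        have : ‖A (fun k => (Xsp (p k)).basis (is k)) j‖₊ = 1 :=
          NNReal.eq (hA1 is his j (Finset.mem_range.1 hj))
        simp [this]
      rw [Finset.sum_congr rfl this]
      simp
  have hn0 : (0 : ℝ) < n := by exact_mod_cast hn
  have hC0 : 0 < C := by linarith
  have hle := hlow.trans (h A)
  rw [← ENNReal.rpow_add_of_nonneg _ _ (Finset.sum_nonneg fun i _ => (one_div_pos.2 (hqq0 i)).le)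
    (by positivity), ← ENNReal.ofReal_natCast, ENNReal.ofReal_rpow_of_pos hn0,
    ENNReal.ofReal_le_ofReal_iff (by positivity)] at hle
  calc _ ≤ C * ‖A‖ := hle
    _ ≤ _ := by
      rw [mul_assoc]
      gcongr
end

section
/- Let m ≥ 1 and p = (p_1,…,p_m) ∈ [1,∞]^m with |1/p| ≤ 1/2. Define ρ = 2m / ( m + 1 − 2|1/p| ). Then there exists a constant C > 0 such that for every continuous m-linear form A : X_{p_1} × ⋯ × X_{p_m} → ℂ, ( Σ_{i_1,…,i_m = 1}^{∞} |A(e_{i_1},…,e_{i_m})|^{ρ} )^{1/ρ} ≤ C‖A‖. -/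
open scoped ENNReal NNReal

theorem sum_rpow_le_one_of_dual {κ : Type*} [Fintype κ] {a c v : ℝ} (ha : 0 < a) (hc : 0 < c)
    (hac : 1 / c = 1 / a - v) {g : κ → ℝ} (hg : ∀ t, 0 ≤ g t)
    (h : ∀ z : κ → ℝ, (∀ t, 0 ≤ z t) → ∑ t, z t ≤ 1 → ∑ t, z t ^ (v * a) * g t ≤ 1) :
    ∑ t, g t ^ (c / a) ≤ 1 := by
  set S := ∑ t, g t ^ (c / a) with hS
  have hS0 : 0 ≤ S := Finset.sum_nonneg fun t _ => Real.rpow_nonneg (hg t) _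
  rcases hS0.eq_or_lt with h0 | h0
  · rw [← h0]; exact zero_le_one
  have hva : v * a = 1 - a / c := by
    have : v = 1 / a - 1 / c := by linarith
    rw [this]; field_simp
  have key := h (fun t => g t ^ (c / a) / S)
    (fun t => div_nonneg (Real.rpow_nonneg (hg t) _) hS0)
    (by rw [← Finset.sum_div, ← hS, div_self h0.ne'])
  have hterm : ∀ t, (g t ^ (c / a) / S) ^ (v * a) * g t = g t ^ (c / a) * S ^ (-(v * a)) := by
    intro t
    rcases (hg t).eq_or_lt with h1 | h1
    · rw [← h1, Real.zero_rpow (by positivity)]; simp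
    rw [Real.div_rpow (by positivity) hS0, ← Real.rpow_mul h1.le, Real.rpow_neg hS0, div_mul_eq_mul_div,
      div_eq_mul_inv]
    congr 1
    nth_rewrite 2 [← Real.rpow_one (g t)]
    rw [← Real.rpow_add h1]
    congr 1
    rw [hva]; field_simp; ring
  simp only [hterm] at key
  rw [← Finset.sum_mul, ← hS] at key
  have : S * S ^ (-(v * a)) = S ^ (a / c) := by
    nth_rewrite 1 [← Real.rpow_one S]
    rw [← Real.rpow_add h0, hva]; congr 1; ring
  rw [this] at key
  by_contra hcon
  exact absurd key (not_le.mpr (Real.one_lt_rpow (not_le.mp hcon) (by positivity)))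

theorem sum_rpow_mul_rpow_le {κ : Type*} [Fintype κ] {θ : ℝ} (h0 : 0 ≤ θ) (h1 : θ ≤ 1)
    {f g : κ → ℝ} (hf : ∀ s, 0 ≤ f s) (hg : ∀ s, 0 ≤ g s) (hfg : ∀ s, f s = 0 ↔ g s = 0) :
    ∑ s, f s ^ θ * g s ^ (1 - θ) ≤ (∑ s, f s) ^ θ * (∑ s, g s) ^ (1 - θ) := by
  have hF : 0 ≤ ∑ s, f s := Finset.sum_nonneg fun s _ => hf s
  have hG : 0 ≤ ∑ s, g s := Finset.sum_nonneg fun s _ => hg s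
  rcases hF.eq_or_lt with hF0 | hF0
  · have hz : ∀ s, f s = 0 := fun s =>
      (Finset.sum_eq_zero_iff_of_nonneg fun s _ => hf s).1 hF0.symm s (Finset.mem_univ s)
    have hz' : ∀ s, g s = 0 := fun s => (hfg s).1 (hz s)
    simp only [hz, hz', Finset.sum_const_zero]
    rcases eq_or_ne θ 0 with rfl | hθ
    · simp
    · simp [Real.zero_rpow hθ]
  rcases hG.eq_or_lt with hG0 | hG0
  · have hz : ∀ s, g s = 0 := fun s =>
      (Finset.sum_eq_zero_iff_of_nonneg fun s _ => hg s).1 hG0.symm s (Finset.mem_univ s)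
    simp [fun s => (hfg s).2 (hz s)] at hF0
  set F := ∑ s, f s with hFd
  set G := ∑ s, g s with hGd
  have hpt : ∀ s, f s ^ θ * g s ^ (1 - θ) ≤
      (F ^ θ * G ^ (1 - θ)) * (θ * (f s / F) + (1 - θ) * (g s / G)) := by
    intro s
    have := Real.geom_mean_le_arith_mean2_weighted h0 (sub_nonneg.2 h1)
      (div_nonneg (hf s) hF) (div_nonneg (hg s) hG) (by ring)
    rw [Real.div_rpow (hf s) hF, Real.div_rpow (hg s) hG, div_mul_div_comm,
      div_le_iff₀ (by positivity)] at this
    linarith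
  calc _ ≤ ∑ s, (F ^ θ * G ^ (1 - θ)) * (θ * (f s / F) + (1 - θ) * (g s / G)) :=
        Finset.sum_le_sum fun s _ => hpt s
    _ = (F ^ θ * G ^ (1 - θ)) * (θ * (F / F) + (1 - θ) * (G / G)) := by
        rw [← Finset.mul_sum, Finset.sum_add_distrib, ← Finset.mul_sum, ← Finset.mul_sum,
          ← Finset.sum_div, ← Finset.sum_div]
    _ = _ := by rw [div_self hF0.ne', div_self hG0.ne']; ring

theorem sum_mul_rpow_mul_le {κ : Type*} [Fintype κ] {a : ℝ} (ha : 0 < a) (ha1 : a ≤ 1)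
    {w y : κ → ℝ} (hw : ∀ t, 0 ≤ w t) (hy : ∀ t, 0 ≤ y t) :
    ∑ t, w t * y t ^ a * (∑ t, w t) ^ (a - 1) ≤ (∑ t, w t * y t) ^ a := by
  set R := ∑ t, w t with hR
  have hR0 : 0 ≤ R := Finset.sum_nonneg fun s _ => hw s
  rcases hR0.eq_or_lt with h0 | h0
  · have hz : ∀ s, w s = 0 := fun s =>
      (Finset.sum_eq_zero_iff_of_nonneg fun s _ => hw s).1 h0.symm s (Finset.mem_univ s)
    simp [hz, Real.zero_rpow ha.ne']
  have := (Real.concaveOn_rpow ha.le ha1).le_map_sum (t := Finset.univ) (w := fun t => w t / R)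
    (p := y) (fun t _ => div_nonneg (hw t) hR0)
    (by rw [← Finset.sum_div, ← hR, div_self h0.ne']) (fun t _ => hy t)
  simp only [smul_eq_mul] at this
  have e1 : ∑ t, w t / R * y t = (∑ t, w t * y t) / R := by
    rw [Finset.sum_div]; exact Finset.sum_congr rfl fun t _ => by ring
  rw [e1, Real.div_rpow (Finset.sum_nonneg fun t _ => mul_nonneg (hw t) (hy t)) hR0,
    le_div_iff₀ (by positivity)] at this
  refine le_trans (le_of_eq ?_) this
  rw [Finset.sum_mul]
  refine Finset.sum_congr rfl fun t _ => ?_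
  rw [Real.rpow_sub_one h0.ne']; ring

/-- Interchanging the rows and the columns of a mixed-norm estimate for a matrix. -/
theorem sum_row_rpow_le_one {κ : Type*} [Fintype κ] {a c v : ℝ} (ha : 0 < a) (hlt : a < c)
    (hc1 : c ≤ 1) (hac : 1 / c = 1 / a - v) {M : κ → κ → ℝ} (hM : ∀ s t, 0 ≤ M s t)
    (h : ∀ z : κ → ℝ, (∀ t, 0 ≤ z t) → ∑ t, z t ≤ 1 → ∑ s, (∑ t, M s t * z t ^ v) ^ a ≤ 1)
    (hcol : ∑ t, (∑ s, M s t) ^ c ≤ 1) :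
    ∑ s, (∑ t, M s t) ^ c ≤ 1 := by
  have hc : 0 < c := ha.trans hlt
  set R : κ → ℝ := fun s => ∑ t, M s t with hR
  have hR0 : ∀ s, 0 ≤ R s := fun s => Finset.sum_nonneg fun t _ => hM s t
  have hMR : ∀ s t, R s = 0 → M s t = 0 := fun s t h0 =>
    (Finset.sum_eq_zero_iff_of_nonneg fun t _ => hM s t).1 h0 t (Finset.mem_univ t)
  set g : κ → ℝ := fun t => ∑ s, M s t * R s ^ (a - 1) with hgd
  have hg0 : ∀ t, 0 ≤ g t := fun t => Finset.sum_nonneg fun s _ =>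
    mul_nonneg (hM s t) (Real.rpow_nonneg (hR0 s) _)
  set H : κ → ℝ := fun t => ∑ s, M s t with hHd
  have hH0 : ∀ t, 0 ≤ H t := fun t => Finset.sum_nonneg fun s _ => hM s t
  have hg : ∑ t, g t ^ (c / a) ≤ 1 := by
    refine sum_rpow_le_one_of_dual ha hc hac hg0 fun z hz hz1 => ?_
    refine le_trans (le_of_eq ?_) ((Finset.sum_le_sum fun s _ =>
      sum_mul_rpow_mul_le ha (hlt.le.trans hc1) (hM s) fun t => Real.rpow_nonneg (hz t) v).trans
      (h z hz hz1))
    simp only [hgd, Finset.mul_sum]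
    rw [Finset.sum_comm]
    refine Finset.sum_congr rfl fun s _ => Finset.sum_congr rfl fun t _ => ?_
    rw [Real.rpow_mul (hz t)]; ring
  set θ := (1 - c) / (1 - a) with hθ
  have h1a : 0 < 1 - a := by linarith
  have hθ0 : 0 ≤ θ := div_nonneg (by linarith) h1a.le
  have hθ1 : θ ≤ 1 := (div_le_one h1a).2 (by linarith)
  have hθm : θ * (1 - a) = 1 - c := div_mul_cancel₀ _ h1a.ne'
  have hpt : ∀ s t, M s t * R s ^ (c - 1) = (M s t * R s ^ (a - 1)) ^ θ * M s t ^ (1 - θ) := by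
    intro s t
    rcases (hM s t).eq_or_lt with h0 | h0
    · rw [← h0]
      rcases eq_or_ne θ 0 with h2 | h2
      · simp [h2]
      · simp [Real.zero_rpow h2]
    have hRp : 0 < R s := lt_of_le_of_ne (hR0 s) fun h2 => h0.ne' (hMR s t h2.symm)
    rw [Real.mul_rpow h0.le (by positivity), ← Real.rpow_mul hRp.le, mul_right_comm,
      ← Real.rpow_add h0]
    congr 1
    · simp
    · congr 1; linarith
  have hcolt : ∀ t, ∑ s, M s t * R s ^ (c - 1) ≤
      θ * a / c * g t ^ (c / a) + (1 - θ) / c * H t ^ c := by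
    intro t
    calc _ = ∑ s, (M s t * R s ^ (a - 1)) ^ θ * M s t ^ (1 - θ) :=
          Finset.sum_congr rfl fun s _ => hpt s t
      _ ≤ g t ^ θ * H t ^ (1 - θ) := by
          refine sum_rpow_mul_rpow_le hθ0 hθ1
            (fun s => mul_nonneg (hM s t) (Real.rpow_nonneg (hR0 s) _)) (fun s => hM s t)
            fun s => ⟨fun h2 => ?_, fun h2 => by rw [h2, zero_mul]⟩
          rcases (hR0 s).eq_or_lt with h3 | h3
          · exact hMR s t h3.symm
          · exact (mul_eq_zero.1 h2).resolve_right (by positivity)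
      _ = (g t ^ (c / a)) ^ (θ * a / c) * (H t ^ c) ^ ((1 - θ) / c) := by
          rw [← Real.rpow_mul (hg0 t), ← Real.rpow_mul (hH0 t)]
          congr 2 <;> field_simp
      _ ≤ _ := by
          refine Real.geom_mean_le_arith_mean2_weighted (by positivity)
            (div_nonneg (by linarith) hc.le) (Real.rpow_nonneg (hg0 t) _)
            (Real.rpow_nonneg (hH0 t) _) ?_
          rw [← add_div, div_eq_one_iff_eq hc.ne']; linarith
  calc ∑ s, R s ^ c = ∑ s, ∑ t, M s t * R s ^ (c - 1) := by
        refine Finset.sum_congr rfl fun s _ => ?_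
        rw [← Finset.sum_mul]
        change _ = R s * _
        rcases (hR0 s).eq_or_lt with h3 | h3
        · rw [← h3, Real.zero_rpow hc.ne', zero_mul]
        · rw [Real.rpow_sub_one h3.ne']; field_simp
    _ = ∑ t, ∑ s, M s t * R s ^ (c - 1) := Finset.sum_comm
    _ ≤ ∑ t, (θ * a / c * g t ^ (c / a) + (1 - θ) / c * H t ^ c) :=
        Finset.sum_le_sum fun t _ => hcolt t
    _ = θ * a / c * ∑ t, g t ^ (c / a) + (1 - θ) / c * ∑ t, H t ^ c := by
        rw [Finset.sum_add_distrib, Finset.mul_sum, Finset.mul_sum]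
    _ ≤ θ * a / c * 1 + (1 - θ) / c * 1 := by
        gcongr
    _ = 1 := by
        rw [mul_one, mul_one, ← add_div, div_eq_one_iff_eq hc.ne']; linarith

/-- The sign attached to a Boolean. -/
def boolSign (b : Bool) : ℂ := bif b then 1 else -1

theorem norm_boolSign (b : Bool) : ‖boolSign b‖ = 1 := by
  cases b <;> simp [boolSign]

theorem sum_fin_succ_bool {α M : Type*} [AddCommMonoid M] [Fintype α] (n : ℕ)
    (f : (Fin (n + 1) → α) → M) :
    ∑ e, f e = ∑ b : α, ∑ e : Fin n → α, f (Fin.cons b e) := by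
  rw [← Fintype.sum_prod_type', ← (Fin.consEquiv fun _ => α).sum_comp]
  rfl

section Hilbert

variable {E : Type*} [NormedAddCommGroup E] [InnerProductSpace ℂ E]

theorem norm_add_sq_add_norm_sub_sq (x v : E) :
    ‖x + v‖ ^ 2 + ‖-x + v‖ ^ 2 = 2 * (‖x‖ ^ 2 + ‖v‖ ^ 2) := by
  have h := parallelogram_law_with_norm ℂ v x
  rw [add_comm x v, neg_add_eq_sub]; nlinarith

theorem norm_add_pow_four_add_norm_sub_pow_four (x v : E) :
    ‖x + v‖ ^ 4 + ‖-x + v‖ ^ 4 ≤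
      2 * (‖x‖ ^ 2 + ‖v‖ ^ 2) ^ 2 + 8 * (‖x‖ ^ 2 * ‖v‖ ^ 2) := by
  have h1 := norm_add_sq (𝕜 := ℂ) v x
  have h2 := norm_sub_sq (𝕜 := ℂ) v x
  have h3 := abs_le.1 ((Complex.abs_re_le_norm _).trans (norm_inner_le_norm (𝕜 := ℂ) v x))
  rw [add_comm x v, neg_add_eq_sub]
  have e : ∀ y : E, ‖y‖ ^ 4 = (‖y‖ ^ 2) ^ 2 := fun y => by ring
  rw [e, e, h1, h2]
  simp only [RCLike.re_to_complex]
  have : (inner ℂ v x).re ^ 2 ≤ (‖v‖ * ‖x‖) ^ 2 := sq_le_sq' h3.1 h3.2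
  nlinarith

theorem sum_norm_sum_boolSign_sq : ∀ (n : ℕ) (v : Fin n → E),
    ∑ e : Fin n → Bool, ‖∑ t, boolSign (e t) • v t‖ ^ 2 = 2 ^ n * ∑ t, ‖v t‖ ^ 2
  | 0, v => by simp
  | n + 1, v => by
    rw [sum_fin_succ_bool, Fintype.sum_bool, ← Finset.sum_add_distrib]
    simp only [Fin.sum_univ_succ, Fin.cons_zero, Fin.cons_succ]
    simp only [boolSign, cond_true, cond_false, one_smul, neg_smul]
    simp only [norm_add_sq_add_norm_sub_sq]
    rw [← Finset.mul_sum, Finset.sum_add_distrib]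
    have := sum_norm_sum_boolSign_sq n (fun t => v t.succ)
    simp only [boolSign] at this
    rw [this]
    simp
    ring

theorem sum_norm_sum_boolSign_pow_four : ∀ (n : ℕ) (v : Fin n → E),
    ∑ e : Fin n → Bool, ‖∑ t, boolSign (e t) • v t‖ ^ 4 ≤ 2 ^ n * (3 * (∑ t, ‖v t‖ ^ 2) ^ 2)
  | 0, v => by simp
  | n + 1, v => by
    have h2 := sum_norm_sum_boolSign_sq n (fun t => v t.succ)
    have h4 := sum_norm_sum_boolSign_pow_four n (fun t => v t.succ)
    rw [sum_fin_succ_bool, Fintype.sum_bool, ← Finset.sum_add_distrib]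
    simp only [Fin.sum_univ_succ, Fin.cons_zero, Fin.cons_succ]
    simp only [boolSign, cond_true, cond_false, one_smul, neg_smul] at *
    refine (Finset.sum_le_sum fun e _ => norm_add_pow_four_add_norm_sub_pow_four _ _).trans ?_
    set S := ∑ t : Fin n, ‖v t.succ‖ ^ 2
    have e1 : ∀ X V : ℝ, 2 * (V ^ 2 + X ^ 2) ^ 2 + 8 * (V ^ 2 * X ^ 2) =
      2 * X ^ 4 + 12 * V ^ 2 * X ^ 2 + 2 * V ^ 4 := fun X V => by ring
    simp only [e1]
    rw [Finset.sum_add_distrib, Finset.sum_add_distrib, ← Finset.mul_sum, ← Finset.mul_sum, h2]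
    simp only [Finset.sum_const, Finset.card_univ, Fintype.card_pi, Fintype.card_bool,
      Finset.prod_const, Fintype.card_fin, nsmul_eq_mul, Nat.cast_pow, Nat.cast_ofNat]
    have h5 : (0 : ℝ) ≤ 2 ^ n * ‖v 0‖ ^ 4 := by positivity
    rw [pow_succ (2 : ℝ) n]
    nlinarith

/-- Khinchine's inequality in a Hilbert space. -/
theorem khinchine_s5 (n : ℕ) (v : Fin n → E) :
    2 ^ n * √(∑ t, ‖v t‖ ^ 2) ≤ √3 * ∑ e : Fin n → Bool, ‖∑ t, boolSign (e t) • v t‖ := by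
  set S := ∑ t, ‖v t‖ ^ 2 with hS
  have hS0 : 0 ≤ S := Finset.sum_nonneg fun t _ => sq_nonneg _
  rcases hS0.eq_or_lt with h0 | h0
  · rw [← h0]; simp only [Real.sqrt_zero, mul_zero]; positivity
  set L := √3 * √S with hL
  have hL0 : 0 < L := by positivity
  have hL2 : L ^ 2 = 3 * S := by
    rw [hL, mul_pow, Real.sq_sqrt (by norm_num), Real.sq_sqrt hS0]
  have hpt : ∀ x : ℝ, 0 ≤ x → 3 * L ^ 2 * x ^ 2 ≤ 2 * L ^ 3 * x + x ^ 4 := by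
    intro x hx
    have : 0 ≤ x * (x - L) ^ 2 * (x + 2 * L) := by positivity
    nlinarith
  have h2 := sum_norm_sum_boolSign_sq n v
  have h4 := sum_norm_sum_boolSign_pow_four n v
  have := Finset.sum_le_sum fun (e : Fin n → Bool) (_ : e ∈ Finset.univ) =>
    hpt _ (norm_nonneg (∑ t, boolSign (e t) • v t))
  rw [← Finset.mul_sum, Finset.sum_add_distrib, ← Finset.mul_sum, h2, ← hS] at this
  rw [← hS] at h4
  set X := ∑ e : Fin n → Bool, ‖∑ t, boolSign (e t) • v t‖
  have h6 : S = L ^ 2 / 3 := by linarith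
  have h7 : L ^ 3 * (2 ^ n * L) ≤ L ^ 3 * (3 * X) := by
    rw [h6] at this h4; nlinarith
  have h8 := le_of_mul_le_mul_left h7 (by positivity)
  have h9 : √3 * √3 = (3 : ℝ) := Real.mul_self_sqrt (by norm_num)
  have h10 : √3 * (2 ^ n * √S) ≤ √3 * (√3 * X) := by
    rw [← mul_assoc √3 √3, h9]; calc _ = 2 ^ n * L := by rw [hL]; ring
      _ ≤ _ := h8
  exact le_of_mul_le_mul_left h10 (by positivity)

end Hilbert

theorem khinchine_multi (n : ℕ) : ∀ (m : ℕ) (c : (Fin m → Fin n) → ℂ),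
    (2 ^ n) ^ m * √(∑ i, ‖c i‖ ^ 2) ≤
      √3 ^ m * ∑ e : Fin m → Fin n → Bool, ‖∑ i, (∏ j, boolSign (e j (i j))) * c i‖
  | 0, c => by simp [Real.sqrt_sq (norm_nonneg _)]
  | m + 1, c => by
    have h1 := khinchine_s5 n fun t => WithLp.toLp 2 (fun i : Fin m → Fin n => c (Fin.cons t i))
    simp only [EuclideanSpace.norm_sq_eq] at h1
    have h2 : ∀ e : Fin n → Bool, ‖∑ t, boolSign (e t) •
        WithLp.toLp 2 (fun i : Fin m → Fin n => c (Fin.cons t i))‖ =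
        √(∑ i : Fin m → Fin n, ‖∑ t, boolSign (e t) * c (Fin.cons t i)‖ ^ 2) := by
      intro e
      rw [EuclideanSpace.norm_eq]
      simp
    simp only [h2] at h1
    rw [sum_fin_succ_bool, sum_fin_succ_bool]
    calc _ = (2 ^ n) ^ m * (2 ^ n * √(∑ b, ∑ e : Fin m → Fin n, ‖c (Fin.cons b e)‖ ^ 2)) := by
          ring
      _ ≤ (2 ^ n) ^ m * (√3 * ∑ e : Fin n → Bool,
            √(∑ i : Fin m → Fin n, ‖∑ t, boolSign (e t) * c (Fin.cons t i)‖ ^ 2)) := by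
          gcongr
      _ = √3 * ∑ e : Fin n → Bool, (2 ^ n) ^ m *
            √(∑ i : Fin m → Fin n, ‖∑ t, boolSign (e t) * c (Fin.cons t i)‖ ^ 2) := by
          rw [← Finset.mul_sum]; ring
      _ ≤ √3 * ∑ e : Fin n → Bool, √3 ^ m * ∑ e' : Fin m → Fin n → Bool,
            ‖∑ i, (∏ j, boolSign (e' j (i j))) * ∑ t, boolSign (e t) * c (Fin.cons t i)‖ := by
          refine mul_le_mul_of_nonneg_left (Finset.sum_le_sum fun e _ => ?_) (by positivity)
          exact khinchine_multi n m _
      _ = _ := by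
          rw [← Finset.mul_sum, pow_succ', mul_assoc]
          congr 2
          refine Finset.sum_congr rfl fun e _ => Finset.sum_congr rfl fun e' _ => ?_
          rw [sum_fin_succ_bool, Finset.sum_comm]
          congr 1
          refine Finset.sum_congr rfl fun i _ => ?_
          rw [Finset.mul_sum]
          refine Finset.sum_congr rfl fun t _ => ?_
          rw [Fin.prod_univ_succ]
          simp only [Fin.cons_zero, Fin.cons_succ]
          ring

/-- The weighted mixed `(2a, 2, …, 2)`-norm estimates for a family `b` of squared moduli, in every
direction `k` and for all weights `w` from the unit ball of `ℓ₁`. -/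
def MixedBound {ι κ : Type*} [Fintype ι] [DecidableEq ι] [Fintype κ] [DecidableEq κ]
    (b : (ι → κ) → ℝ) (u : ι → ℝ) (a : ℝ) : Prop :=
  ∀ w : ι → κ → ℝ, (∀ j t, 0 ≤ w j t) → (∀ j, ∑ t, w j t ≤ 1) →
    ∀ k, ∑ s, (∑ i with i k = s, b i * ∏ j, w j (i j) ^ u j) ^ a ≤ 1

theorem exists_norm_le_one_mul_eq_norm (z : ℂ) : ∃ θ : ℂ, ‖θ‖ ≤ 1 ∧ θ * z = ‖z‖ := by
  rcases eq_or_ne z 0 with rfl | hz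
  · exact ⟨0, by simp⟩
  · have hz' : (‖z‖ : ℂ) ≠ 0 := by simpa using hz
    refine ⟨(starRingEnd ℂ) z / ‖z‖, by simp [hz], ?_⟩
    rw [div_mul_eq_mul_div, Complex.conj_mul', div_eq_iff hz']; ring

theorem mixedBound_of_form {m n : ℕ} {u : Fin m → ℝ} {a : (Fin m → Fin n) → ℂ}
    (h : ∀ w : Fin m → Fin n → ℝ, (∀ j t, 0 ≤ w j t) → (∀ j, ∑ t, w j t ≤ 1) →
      ∀ x : Fin m → Fin n → ℂ, (∀ j t, ‖x j t‖ ≤ w j t ^ u j) →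
        ‖∑ i, (∏ j, x j (i j)) * a i‖ ≤ 1) :
    MixedBound (fun i => ‖a i‖ ^ 2 / 3 ^ m) (fun j => 2 * u j) (1 / 2) := by
  intro w hw hw1 k
  set d : Fin n → (Fin m → Fin n) → ℂ := fun s i =>
    if i k = s then (∏ j, ((w j (i j) ^ u j : ℝ) : ℂ)) * a i else 0 with hd
  have hsq : ∀ s, (∑ i with i k = s, ‖a i‖ ^ 2 / 3 ^ m * ∏ j, w j (i j) ^ (2 * u j)) ^ (1 / 2 : ℝ) =
      √(∑ i, ‖d s i‖ ^ 2) / √3 ^ m := by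
    intro s
    rw [← Real.sqrt_eq_rpow]
    have h3 : √3 ^ m = √(3 ^ m : ℝ) := by
      rw [eq_comm, Real.sqrt_eq_iff_eq_sq (by positivity) (by positivity), ← pow_mul, mul_comm m 2,
        pow_mul, Real.sq_sqrt (by norm_num)]
    rw [h3, ← Real.sqrt_div' _ (by positivity), Finset.sum_filter, Finset.sum_div]
    congr 1
    refine Finset.sum_congr rfl fun i _ => ?_
    by_cases hi : i k = s
    · simp only [hd, hi, if_true, norm_mul, norm_prod, Complex.norm_real, mul_pow,
        ← Finset.prod_pow, Real.norm_eq_abs, sq_abs]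
      have : ∀ j, w j (i j) ^ (2 * u j) = (w j (i j) ^ u j) ^ 2 := fun j => by
        rw [mul_comm, Real.rpow_mul (hw _ _)]; norm_cast
      simp only [this]; ring
    · simp [hd, hi]
  simp only [hsq]
  have hform : ∀ e : Fin m → Fin n → Bool,
      ∑ s, ‖∑ i, (∏ j, boolSign (e j (i j))) * d s i‖ ≤ 1 := by
    intro e
    choose θ hθ1 hθ using fun s =>
      exists_norm_le_one_mul_eq_norm (∑ i, (∏ j, boolSign (e j (i j))) * d s i)
    have := h w hw hw1
      (fun j t => boolSign (e j t) * ((w j t ^ u j : ℝ) : ℂ) * if j = k then θ t else 1)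
      (fun j t => by
        have h0 : 0 ≤ w j t ^ u j := Real.rpow_nonneg (hw j t) _
        rw [norm_mul, norm_mul, norm_boolSign, one_mul, Complex.norm_real, Real.norm_eq_abs,
          abs_of_nonneg h0]
        refine mul_le_of_le_one_right h0 ?_
        split_ifs
        · exact hθ1 t
        · simp)
    have e2 : ∑ i, (∏ j, (boolSign (e j (i j)) * ((w j (i j) ^ u j : ℝ) : ℂ) *
        if j = k then θ (i j) else 1)) * a i =
        ((∑ s, ‖∑ i, (∏ j, boolSign (e j (i j))) * d s i‖ : ℝ) : ℂ) := by
      rw [Complex.ofReal_sum]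
      simp only [← hθ, Finset.mul_sum]
      rw [Finset.sum_comm]
      refine Finset.sum_congr rfl fun i _ => ?_
      simp only [Finset.prod_mul_distrib, Finset.prod_ite_eq', Finset.mem_univ, if_true]
      simp only [hd, mul_ite, mul_zero, Finset.sum_ite_eq, Finset.mem_univ, if_true]
      ring
    rw [e2, Complex.norm_real] at this
    exact (le_abs_self _).trans this
  have h3p : (0 : ℝ) < √3 ^ m := by positivity
  have h2p : (0 : ℝ) < (2 ^ n) ^ m := by positivity
  rw [← Finset.sum_div, div_le_one h3p]
  refine le_of_mul_le_mul_left ?_ h2p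
  calc _ = ∑ s, (2 ^ n) ^ m * √(∑ i, ‖d s i‖ ^ 2) := Finset.mul_sum _ _ _
    _ ≤ ∑ s, √3 ^ m * ∑ e : Fin m → Fin n → Bool, ‖∑ i, (∏ j, boolSign (e j (i j))) * d s i‖ :=
        Finset.sum_le_sum fun s _ => khinchine_multi n m _
    _ = √3 ^ m * ∑ e : Fin m → Fin n → Bool, ∑ s, ‖∑ i, (∏ j, boolSign (e j (i j))) * d s i‖ := by
        rw [← Finset.mul_sum, Finset.sum_comm]
    _ ≤ √3 ^ m * ∑ e : Fin m → Fin n → Bool, 1 := by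
        gcongr with e; exact hform e
    _ = _ := by
        simp only [Finset.sum_const, Finset.card_univ, Fintype.card_pi, Fintype.card_bool,
          Finset.prod_const, Fintype.card_fin, nsmul_eq_mul, mul_one]
        push_cast; ring

section MixedBound

variable {ι κ : Type*} [Fintype ι] [DecidableEq ι] [Fintype κ] [DecidableEq κ]

/-- Absorbing the weight of the coordinate `l`. -/
theorem MixedBound.update {b : (ι → κ) → ℝ} (hb : ∀ i, 0 ≤ b i) {u : ι → ℝ} {a c : ℝ}
    (h : MixedBound b u a) (ha : 0 < a) (hc1 : c ≤ 1) (l : ι) (hlt : a < c)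
    (hac : 1 / c = 1 / a - u l) : MixedBound b (Function.update u l 0) c := by
  intro w hw hw1
  set B : (ι → κ) → ℝ := fun i => b i * ∏ j, w j (i j) ^ Function.update u l 0 j with hB
  have hB0 : ∀ i, 0 ≤ B i := fun i => mul_nonneg (hb i) <|
    Finset.prod_nonneg fun j _ => Real.rpow_nonneg (hw _ _) _
  have key : ∀ z : κ → ℝ, (∀ t, 0 ≤ z t) → ∑ t, z t ≤ 1 → ∀ k,
      ∑ s, (∑ i with i k = s, B i * z (i l) ^ u l) ^ a ≤ 1 := by
    intro z hz hz1 k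
    have := h (Function.update w l z) (fun j t => ?_) (fun j => ?_) k
    · refine le_trans (le_of_eq ?_) this
      refine Finset.sum_congr rfl fun s _ => congrArg (· ^ a) (Finset.sum_congr rfl fun i _ => ?_)
      simp only [hB]
      rw [mul_assoc]
      congr 1
      rw [← Finset.prod_erase_mul _ _ (Finset.mem_univ l),
        ← Finset.prod_erase_mul Finset.univ (fun j => Function.update w l z j (i j) ^ u j)
          (Finset.mem_univ l)]
      simp only [Function.update_self, Real.rpow_zero, mul_one]
      congr 1
      refine Finset.prod_congr rfl fun j hj => ?_
      rw [Function.update_of_ne (Finset.ne_of_mem_erase hj),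
        Function.update_of_ne (Finset.ne_of_mem_erase hj)]
    · rcases eq_or_ne j l with rfl | hj
      · simpa using hz t
      · simpa [hj] using hw j t
    · rcases eq_or_ne j l with rfl | hj
      · simpa using hz1
      · simpa [hj] using hw1 j
  have hcol : ∑ t, (∑ i with i l = t, B i) ^ c ≤ 1 := by
    have hH : ∀ t, 0 ≤ ∑ i with i l = t, B i := fun t => Finset.sum_nonneg fun i _ => hB0 i
    have := sum_rpow_le_one_of_dual ha (ha.trans hlt) hac
      (g := fun t => (∑ i with i l = t, B i) ^ a) (fun t => Real.rpow_nonneg (hH t) _)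
      fun z hz hz1 => by
        refine le_trans (le_of_eq ?_) (key z hz hz1 l)
        refine Finset.sum_congr rfl fun t _ => ?_
        rw [Real.rpow_mul (hz t), ← Real.mul_rpow (Real.rpow_nonneg (hz t) _) (hH t),
          Finset.mul_sum]
        congr 1
        refine Finset.sum_congr rfl fun i hi => ?_
        rw [(Finset.mem_filter.1 hi).2, mul_comm]
    convert this using 2 with t
    rw [← Real.rpow_mul (hH t), mul_div_cancel₀ _ ha.ne']
  intro k
  rcases eq_or_ne k l with rfl | hk
  · exact hcol
  have hrow : ∀ (f : (ι → κ) → ℝ) (p q : ι) (s : κ),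
      ∑ i with i p = s, f i = ∑ t, ∑ i with i p = s ∧ i q = t, f i := by
    intro f p q s
    rw [← Finset.sum_fiberwise _ (fun i => i q)]
    simp only [Finset.filter_filter]
  have := sum_row_rpow_le_one ha hlt hc1 hac (M := fun s t => ∑ i with i k = s ∧ i l = t, B i)
    (fun s t => Finset.sum_nonneg fun i _ => hB0 i)
    (fun z hz hz1 => by
      refine le_trans (le_of_eq ?_) (key z hz hz1 k)
      refine Finset.sum_congr rfl fun s _ => ?_
      rw [hrow _ k l]
      congr 1
      refine Finset.sum_congr rfl fun t _ => ?_
      rw [Finset.sum_mul]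
      refine Finset.sum_congr rfl fun i hi => ?_
      rw [(Finset.mem_filter.1 hi).2.2])
    (by
      convert hcol using 3 with t
      rw [hrow _ l k]
      simp only [and_comm])
  convert this using 3 with s
  exact hrow _ k l s

/-- Interpolation of the mixed-norm estimates in all directions. -/
theorem MixedBound.sum_rpow_le_one [Nonempty ι] {b : (ι → κ) → ℝ} (hb : ∀ i, 0 ≤ b i) {c r : ℝ}
    (h : MixedBound b 0 c) (hc : 0 < c) (hr : 0 < r) (hr1 : r ≤ 1)
    (hcr : r * (1 - c) = (Fintype.card ι : ℝ) * (c * (1 - r))) :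
    ∑ i, b i ^ r ≤ 1 := by
  set N : ℝ := (Fintype.card ι : ℝ) with hN
  have hN0 : 0 < N := by simp [hN, Fintype.card_pos]
  set M : ι → κ → ℝ := fun k s => ∑ i with i k = s, b i with hM
  have hM0 : ∀ k s, 0 ≤ M k s := fun k s => Finset.sum_nonneg fun i _ => hb i
  have hMb : ∀ k i, b i ≤ M k (i k) := fun k i =>
    Finset.single_le_sum (f := b) (fun i _ => hb i) (by simp)
  have hMc : ∀ k, ∑ s, M k s ^ c ≤ 1 := by
    intro k
    have := h (fun _ _ => 0) (fun _ _ => le_rfl) (fun _ => by simp) k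
    simpa using this
  have hpt : ∀ i, b i ^ r ≤
      r * ∑ k, N⁻¹ * (b i * M k (i k) ^ (c - 1)) + (1 - r) * ∏ k, M k (i k) ^ c := by
    intro i
    rcases (hb i).eq_or_lt with h0 | h0
    · rw [← h0, Real.zero_rpow hr.ne']
      have : 0 ≤ ∏ k, M k (i k) ^ c := Finset.prod_nonneg fun k _ => Real.rpow_nonneg (hM0 _ _) _
      simpa using mul_nonneg (sub_nonneg.2 hr1) this
    have hMp : ∀ k, 0 < M k (i k) := fun k => h0.trans_le (hMb k i)
    have hgm := Real.geom_mean_le_arith_mean_weighted Finset.univ (fun _ : ι => N⁻¹)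
      (fun k => b i * M k (i k) ^ (c - 1)) (fun _ _ => by positivity)
      (by simp [hN]) (fun k _ => mul_nonneg h0.le (Real.rpow_nonneg (hM0 _ _) _))
    have hP : 0 ≤ ∏ k, M k (i k) ^ c := Finset.prod_nonneg fun k _ => Real.rpow_nonneg (hM0 _ _) _
    have hQ : 0 ≤ ∏ k, (b i * M k (i k) ^ (c - 1)) ^ N⁻¹ := Finset.prod_nonneg fun k _ =>
      Real.rpow_nonneg (mul_nonneg h0.le (Real.rpow_nonneg (hM0 _ _) _)) _
    have hgm2 := Real.geom_mean_le_arith_mean2_weighted hr.le (sub_nonneg.2 hr1) hQ hP (by ring)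
    have heq : b i ^ r =
        (∏ k, (b i * M k (i k) ^ (c - 1)) ^ N⁻¹) ^ r * (∏ k, M k (i k) ^ c) ^ (1 - r) := by
      rw [← Real.finsetProd_rpow _ _ fun k _ =>
          Real.rpow_nonneg (mul_nonneg h0.le (Real.rpow_nonneg (hM0 _ _) _)) _,
        ← Real.finsetProd_rpow _ _ fun k _ => Real.rpow_nonneg (hM0 _ _) _,
        ← Finset.prod_mul_distrib]
      have : ∀ k, ((b i * M k (i k) ^ (c - 1)) ^ N⁻¹) ^ r * (M k (i k) ^ c) ^ (1 - r) =
          (b i ^ r) ^ N⁻¹ := by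
        intro k
        have hk := hMp k
        rw [← Real.rpow_mul (by positivity), Real.mul_rpow h0.le (by positivity),
          ← Real.rpow_mul hk.le, ← Real.rpow_mul hk.le, ← Real.rpow_mul h0.le, mul_assoc,
          ← Real.rpow_add hk]
        have : (c - 1) * (N⁻¹ * r) + c * (1 - r) = 0 := by
          field_simp; linarith
        rw [this, Real.rpow_zero, mul_one, mul_comm]
      simp only [this, Finset.prod_const, Finset.card_univ]
      rw [← Real.rpow_natCast, ← hN, ← Real.rpow_mul (by positivity), inv_mul_cancel₀ hN0.ne',
        Real.rpow_one]
    rw [heq]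
    refine hgm2.trans ?_
    gcongr
  have hsum : ∀ k, ∑ i, b i * M k (i k) ^ (c - 1) ≤ 1 := by
    intro k
    refine le_trans (le_of_eq ?_) (hMc k)
    rw [← Finset.sum_fiberwise _ (fun i : ι → κ => i k)]
    refine Finset.sum_congr rfl fun s _ => ?_
    have : ∑ i with i k = s, b i * M k (i k) ^ (c - 1) = M k s * M k s ^ (c - 1) := by
      rw [hM, Finset.sum_mul]
      exact Finset.sum_congr rfl fun i hi => by rw [(Finset.mem_filter.1 hi).2]
    rw [this]
    rcases (hM0 k s).eq_or_lt with h3 | h3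
    · rw [← h3, Real.zero_rpow hc.ne', zero_mul]
    · rw [Real.rpow_sub_one h3.ne']; field_simp
  have hprod : ∑ i : ι → κ, ∏ k, M k (i k) ^ c ≤ 1 := by
    have := Finset.prod_univ_sum (fun _ : ι => (Finset.univ : Finset κ)) fun k s => M k s ^ c
    rw [Fintype.piFinset_univ] at this
    rw [← this]
    exact Finset.prod_le_one
      (fun k _ => Finset.sum_nonneg fun s _ => Real.rpow_nonneg (hM0 _ _) _) fun k _ => hMc k
  calc _ ≤ ∑ i, (r * ∑ k, N⁻¹ * (b i * M k (i k) ^ (c - 1)) +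
          (1 - r) * ∏ k, M k (i k) ^ c) := Finset.sum_le_sum fun i _ => hpt i
    _ = r * ∑ k, N⁻¹ * ∑ i, b i * M k (i k) ^ (c - 1) +
          (1 - r) * ∑ i : ι → κ, ∏ k, M k (i k) ^ c := by
        rw [Finset.sum_add_distrib, ← Finset.mul_sum, ← Finset.mul_sum, Finset.sum_comm]
        simp only [Finset.mul_sum]
    _ ≤ r * ∑ k : ι, N⁻¹ * 1 + (1 - r) * 1 := by
        have : 0 ≤ 1 - r := sub_nonneg.2 hr1
        gcongr with k
        exact hsum k
    _ = 1 := by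
        simp [← hN, hN0.ne']

theorem MixedBound.zero_of_sum_le {b : (ι → κ) → ℝ} (hb : ∀ i, 0 ≤ b i) {u : ι → ℝ}
    (hu : ∀ j, 0 ≤ u j) (hu1 : ∑ j, u j ≤ 1 / 2) (h : MixedBound b (fun j => 2 * u j) (1 / 2)) :
    MixedBound b 0 (1 / (2 - 2 * ∑ j, u j)) := by
  have key : ∀ T : Finset ι,
      MixedBound b (fun j => if j ∈ T then 0 else 2 * u j) (1 / (2 - 2 * ∑ j ∈ T, u j)) := by
    intro T
    induction T using Finset.induction_on with
    | empty => simpa using h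
    | insert l T hl ih =>
      have hle : ∑ j ∈ insert l T, u j ≤ 1 / 2 :=
        (Finset.sum_le_univ_sum_of_nonneg hu).trans hu1
      rw [Finset.sum_insert hl] at hle ⊢
      have hT : 0 ≤ ∑ j ∈ T, u j := Finset.sum_nonneg fun j _ => hu j
      have hfun : (fun j => if j ∈ insert l T then 0 else 2 * u j) =
          Function.update (fun j => if j ∈ T then 0 else 2 * u j) l 0 := by
        ext j
        rcases eq_or_ne j l with rfl | hj
        · simp
        · simp [hj]
      rw [hfun]
      rcases (hu l).eq_or_lt with h0 | h0
      · rw [← h0, zero_add]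
        convert ih using 1
        rw [Function.update_eq_self_iff]
        simp [hl, ← h0]
      · refine ih.update hb ?_ ?_ l ?_ ?_
        · exact one_div_pos.2 (by linarith)
        · exact (div_le_one (by linarith)).2 (by linarith)
        · exact one_div_lt_one_div_of_lt (by linarith) (by linarith)
        · simp only [one_div_one_div, hl, if_false]; ring
  have := key Finset.univ
  simp only [Finset.mem_univ, if_true] at this
  exact this

end MixedBound

/-- The finite-dimensional Hardy–Littlewood inequality. -/
theorem sum_norm_rpow_le_of_form {m n : ℕ} (hm : 1 ≤ m) {u : Fin m → ℝ} (hu : ∀ j, 0 ≤ u j)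
    (hu1 : ∑ j, u j ≤ 1 / 2) {ρ : ℝ} (hρ : ρ = 2 * m / (m + 1 - 2 * ∑ j, u j))
    {a : (Fin m → Fin n) → ℂ} {D : ℝ} (hD : 0 < D)
    (h : ∀ w : Fin m → Fin n → ℝ, (∀ j t, 0 ≤ w j t) → (∀ j, ∑ t, w j t ≤ 1) →
      ∀ x : Fin m → Fin n → ℂ, (∀ j t, ‖x j t‖ ≤ w j t ^ u j) →
        ‖∑ i, (∏ j, x j (i j)) * a i‖ ≤ D) :
    ∑ i, ‖a i‖ ^ ρ ≤ (√3 ^ m * D) ^ ρ := by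
  have hm' : (1 : ℝ) ≤ m := by exact_mod_cast hm
  have : Nonempty (Fin m) := ⟨⟨0, hm⟩⟩
  have hden : 0 < (m : ℝ) + 1 - 2 * ∑ j, u j := by linarith
  have hρ0 : 0 < ρ := by rw [hρ]; positivity
  have hbase := mixedBound_of_form (u := u) (a := fun i => a i / D) fun w hw hw1 x hx => by
    have := h w hw hw1 x hx
    simp only [← mul_div_assoc]
    rw [← Finset.sum_div, norm_div, Complex.norm_real, Real.norm_eq_abs, abs_of_pos hD]
    exact (div_le_one hD).2 this
  have hb : ∀ i : Fin m → Fin n, 0 ≤ ‖a i / D‖ ^ 2 / 3 ^ m := fun i => by positivity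
  have hs : 0 < 2 - 2 * ∑ j, u j := by linarith
  have hs0 : 0 ≤ ∑ j, u j := Finset.sum_nonneg fun j _ => hu j
  have := (hbase.zero_of_sum_le hb hu hu1).sum_rpow_le_one hb (r := ρ / 2)
    (one_div_pos.2 hs) (by positivity)
    (by
      rw [hρ, div_div, div_le_one (by positivity)]; linarith)
    (by
      have hs1 : 1 - ∑ j, u j ≠ 0 := by linarith
      rw [Fintype.card_fin, hρ]; field_simp; ring)
  have e : ∀ i, (‖a i / D‖ ^ 2 / 3 ^ m) ^ (ρ / 2) = ‖a i‖ ^ ρ / (√3 ^ m * D) ^ ρ := by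
    intro i
    have : ‖a i / D‖ ^ 2 / 3 ^ m = (‖a i‖ / (√3 ^ m * D)) ^ (2 : ℝ) := by
      rw [norm_div, Complex.norm_real, Real.norm_eq_abs, abs_of_pos hD, Real.rpow_two, div_pow,
        div_pow, mul_pow, ← pow_mul, mul_comm m 2, pow_mul, Real.sq_sqrt (by norm_num), div_div,
        mul_comm]
    rw [this, ← Real.rpow_mul (by positivity), mul_div_cancel₀ _ two_ne_zero,
      Real.div_rpow (by positivity) (by positivity)]
  simp only [e] at this
  rwa [← Finset.sum_div, div_le_one (by positivity)] at this

theorem ZeroAtInftyContinuousMap.sum_apply {ι : Type*} (s : Finset ι)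
    (f : ι → ZeroAtInftyContinuousMap ℕ ℂ) (l : ℕ) : (∑ t ∈ s, f t) l = ∑ t ∈ s, f t l := by
  classical
  induction s using Finset.induction_on with
  | empty => simp
  | insert a s ha ih => rw [Finset.sum_insert ha, Finset.sum_insert ha, add_apply, ih]

theorem norm_sum_smul_basis_le_one (p : ℝ≥0∞) [hp : Fact (1 ≤ p)] {n : ℕ} {w : Fin n → ℝ}
    (hw : ∀ t, 0 ≤ w t) (hw1 : ∑ t, w t ≤ 1) {x : Fin n → ℂ}
    (hx : ∀ t, ‖x t‖ ≤ w t ^ (p⁻¹).toReal) :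
    ‖∑ t : Fin n, x t • (Xsp p).basis t‖ ≤ 1 := by
  by_cases h : p = ∞
  · rw [Xsp, if_pos h]
    change ‖((∑ t : Fin n, x t • _ : ZeroAtInftyContinuousMap ℕ ℂ)).toBCF‖ ≤ 1
    refine (BoundedContinuousFunction.norm_le zero_le_one).2 fun l => ?_
    change ‖(∑ t : Fin n, x t • _ : ZeroAtInftyContinuousMap ℕ ℂ) l‖ ≤ 1
    rw [ZeroAtInftyContinuousMap.sum_apply]
    simp only [ZeroAtInftyContinuousMap.smul_apply, smul_eq_mul]
    change ‖∑ t : Fin n, x t * (if l = t then 1 else 0)‖ ≤ 1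
    by_cases hl : l < n
    · rw [Finset.sum_eq_single (⟨l, hl⟩ : Fin n)]
      · simpa [h] using hx ⟨l, hl⟩
      · intro t _ ht
        rw [if_neg, mul_zero]
        rintro rfl
        exact ht rfl
      · simp
    · rw [Finset.sum_eq_zero]
      · simp
      · intro t _
        rw [if_neg, mul_zero]
        rintro rfl
        exact hl t.2
  · rw [Xsp, if_neg h]
    have hp0 : 0 < p.toReal := ENNReal.toReal_pos (zero_lt_one.trans_le hp.out).ne' h
    change ‖(∑ t : Fin n, x t • lp.single p (t : ℕ) 1 : lp (fun _ : ℕ => ℂ) p)‖ ≤ 1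
    set f : ℕ → ℂ := fun l => if hl : l < n then x ⟨l, hl⟩ else 0 with hf
    have e : (∑ t : Fin n, x t • lp.single p (t : ℕ) 1 : lp (fun _ : ℕ => ℂ) p) =
        ∑ l ∈ Finset.range n, lp.single p l (f l) := by
      rw [Finset.sum_range]
      refine Finset.sum_congr rfl fun t _ => ?_
      rw [← lp.single_smul]
      simp [hf]
    have := lp.norm_sum_single hp0 f (Finset.range n)
    rw [← e, Finset.sum_range] at this
    refine (Real.rpow_le_rpow_iff (norm_nonneg _) zero_le_one hp0).1 ?_
    rw [this, Real.one_rpow]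
    refine (Finset.sum_le_sum fun t _ => ?_).trans hw1
    simp only [hf, Fin.is_lt, dif_pos]
    refine (Real.rpow_le_rpow (norm_nonneg _) (hx t) hp0.le).trans_eq ?_
    rw [← Real.rpow_mul (hw t), ENNReal.toReal_inv, inv_mul_cancel₀ hp0.ne', Real.rpow_one]

theorem ContinuousMultilinearMap.norm_sum_prod_mul_le {m n : ℕ} {E : Fin m → Type*}
    [∀ k, NormedAddCommGroup (E k)] [∀ k, NormedSpace ℂ (E k)]
    (A : ContinuousMultilinearMap ℂ E ℂ) (e : ∀ k, Fin n → E k) (x : Fin m → Fin n → ℂ)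
    (hx : ∀ k, ‖∑ t, x k t • e k t‖ ≤ 1) :
    ‖∑ i : Fin m → Fin n, (∏ j, x j (i j)) * A fun k => e k (i k)‖ ≤ ‖A‖ := by
  have h := A.map_sum fun k t => x k t • e k t
  simp only [A.map_smul_univ, smul_eq_mul] at h
  rw [← h]
  refine (A.le_opNorm _).trans (mul_le_of_le_one_right (norm_nonneg _) ?_)
  exact Finset.prod_le_one (fun _ _ => norm_nonneg _) fun k _ => hx k

theorem ENNReal.tsum_pi_nat_le {m : ℕ} {F : (Fin m → ℕ) → ℝ≥0∞} {D : ℝ≥0∞}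
    (h : ∀ n : ℕ, ∑ i : Fin m → Fin n, F (fun k => i k) ≤ D) : ∑' i, F i ≤ D := by
  rw [ENNReal.tsum_eq_iSup_sum]
  refine iSup_le fun s => ?_
  obtain ⟨n, hn⟩ : ∃ n : ℕ, ∀ i ∈ s, ∀ k, i k < n := by
    refine ⟨s.sup (fun i => Finset.univ.sup i) + 1, fun i hi k => Nat.lt_succ_of_le ?_⟩
    exact (Finset.le_sup (f := i) (Finset.mem_univ k)).trans
      (Finset.le_sup (f := fun i => Finset.univ.sup i) hi)
  refine le_trans ?_ (h n)
  have hinj : Function.Injective fun (i : Fin m → Fin n) (k : Fin m) => (i k : ℕ) :=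
    fun i i' hii => funext fun k => Fin.ext (congrFun hii k)
  rw [← Finset.sum_image (f := F) (g := fun (i : Fin m → Fin n) (k : Fin m) => (i k : ℕ))
    fun i _ i' _ hii => hinj hii]
  refine Finset.sum_le_sum_of_subset fun i hi => Finset.mem_image.2
    ⟨fun k => ⟨i k, hn i hi k⟩, Finset.mem_univ _, rfl⟩

/-- **Praciano-Pereira's theorem.** Let `m ≥ 1` and `p = (p₁, …, p_m) ∈ [1,∞]^m` with
`|1/p| ≤ 1/2`, and set `ρ = 2m/(m + 1 - 2|1/p|)`. Then there is a constant `C > 0` such that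
`(Σ_{i₁,…,i_m} |A(e_{i₁},…,e_{i_m})|^ρ)^{1/ρ} ≤ C‖A‖` for every continuous `m`-linear form
`A : X_{p₁} × ⋯ × X_{p_m} → ℂ`. -/
theorem praciano_pereira (m : ℕ) (hm : 1 ≤ m)
    (p : Fin m → ℝ≥0∞) [∀ k, Fact (1 ≤ p k)]
    (hp : ∑ k, ((p k)⁻¹).toReal ≤ 1 / 2)
    (ρ : ℝ) (hρ : ρ = 2 * m / (m + 1 - 2 * ∑ k, ((p k)⁻¹).toReal)) :
    ∃ C : ℝ, 0 < C ∧
      ∀ A : ContinuousMultilinearMap ℂ (fun k => (Xsp (p k)).carrier) ℂ,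
        (∑' is : Fin m → ℕ,
            (‖A (fun k => (Xsp (p k)).basis (is k))‖₊ : ℝ≥0∞) ^ ρ) ^ (1 / ρ) ≤
          ENNReal.ofReal (C * ‖A‖) := by
  have hm' : (1 : ℝ) ≤ m := by exact_mod_cast hm
  have hden : 0 < (m : ℝ) + 1 - 2 * ∑ k, ((p k)⁻¹).toReal := by linarith
  have hρ0 : 0 < ρ := by rw [hρ]; positivity
  refine ⟨√3 ^ m, by positivity, fun A => ?_⟩
  rcases (norm_nonneg A).eq_or_lt with h0 | h0
  · have hA : A = 0 := norm_eq_zero.1 h0.symm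
    simp [hA, ENNReal.zero_rpow_of_pos hρ0, hρ0]
  rw [one_div, ENNReal.rpow_inv_le_iff hρ0]
  refine ENNReal.tsum_pi_nat_le
    (F := fun is => (‖A (fun k => (Xsp (p k)).basis (is k))‖₊ : ℝ≥0∞) ^ ρ) fun n => ?_
  have := sum_norm_rpow_le_of_form hm (fun k => ENNReal.toReal_nonneg) hp hρ (n := n)
    (a := fun i => A fun k => (Xsp (p k)).basis (i k)) h0
    fun w hw hw1 x hx => A.norm_sum_prod_mul_le (fun k t => (Xsp (p k)).basis t) x
      fun k => norm_sum_smul_basis_le_one (p k) (hw k) (hw1 k) (hx k)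
  rw [ENNReal.ofReal_rpow_of_nonneg (by positivity) hρ0.le]
  refine le_trans (le_of_eq ?_) (ENNReal.ofReal_le_ofReal this)
  rw [ENNReal.ofReal_sum_of_nonneg fun i _ => by positivity]
  refine Finset.sum_congr rfl fun i _ => ?_
  rw [← ENNReal.ofReal_rpow_of_nonneg (norm_nonneg _) hρ0.le, ofReal_norm, enorm_eq_nnnorm]
end

section
/- Let Z and Y be complex Banach spaces, let N, m ≥ 1, and for each k ∈ {1,…,N} let q(k) ∈ [1,∞)^m. Let T be a linear map from Z into the space of Y-valued families indexed by ℕ^m such that, for each k ∈ {1,…,N}, ‖Tz‖_{ℓ_{q(k)}(Y)} ≤ C‖z‖_Z for all z ∈ Z. Then for any q = (q_1,…,q_m) ∈ (1,∞)^m such that the point (1/q_1,…,1/q_m) belongs to the convex hull of the points (1/q_1(k),…,1/q_m(k)), k = 1,…,N, one has ‖Tz‖_{ℓ_q(Y)} ≤ C‖z‖_Z for all z ∈ Z. -/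
open scoped ENNReal NNReal

open MeasureTheory in
/-- Generalized Hölder inequality for sums in `ℝ≥0∞`. -/
theorem tsum_prod_rpow_le_prod_tsum_rpow {ι : Type*} [Fintype ι] (p : ι → ℝ)
    (hp : ∀ k, 0 ≤ p k) (hsum : ∑ k, p k = 1) (f : ι → ℕ → ℝ≥0∞) :
    ∑' i, ∏ k, f k i ^ p k ≤ ∏ k, (∑' i, f k i) ^ p k := by
  have h := ENNReal.lintegral_prod_norm_pow_le (μ := Measure.count) Finset.univ
    (f := f) (fun k _ => (measurable_of_countable _).aemeasurable) hsum (fun k _ => hp k)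
  simpa only [lintegral_count] using h

theorem prod_rpow_eq_self_of_sum_eq_one {ι : Type*} [Fintype ι] (w : ι → ℝ)
    (hw : ∀ k, 0 ≤ w k) (hsum : ∑ k, w k = 1) (a : ℝ≥0∞) : ∏ k, a ^ w k = a := by
  have h : ∀ s : Finset ι, ∏ k ∈ s, a ^ w k = a ^ ∑ k ∈ s, w k := by
    classical
    intro s
    induction s using Finset.induction_on with
    | empty => simp
    | insert k s hk ih =>
      rw [Finset.prod_insert hk, Finset.sum_insert hk, ih,
        ENNReal.rpow_add_of_nonneg _ _ (hw k) (Finset.sum_nonneg fun j _ => hw j)]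
  rw [h, hsum, ENNReal.rpow_one]

/-- Hölder inequality for mixed norms. -/
theorem mixedNorm_prod_rpow_le_s6 {ι : Type*} [Fintype ι] (w : ι → ℝ) (hw : ∀ k, 0 ≤ w k) :
    ∀ (m : ℕ) (q : Fin m → ℝ) (r : ι → Fin m → ℝ), (∀ j, 0 < q j) → (∀ k j, 0 < r k j) →
      (∀ j, ∑ k, w k * (1 / r k j) = 1 / q j) → ∀ a : ι → (Fin m → ℕ) → ℝ≥0∞,
      mixedNorm m q (fun i => ∏ k, a k i ^ w k) ≤ ∏ k, mixedNorm m (r k) (a k) ^ w k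
  | 0, _, _, _, _, _, _ => le_rfl
  | m + 1, q, r, hq, hr, hqr, a => by
    have ih := fun i => mixedNorm_prod_rpow_le_s6 w hw m (fun j => q j.succ) (fun k j => r k j.succ)
      (fun j => hq _) (fun k j => hr _ _) (fun j => hqr _) (fun k is => a k (Fin.cons i is))
    have hq0 := hq 0
    have hsum : ∑ k, q 0 * (w k * (1 / r k 0)) = 1 := by
      rw [← Finset.mul_sum, hqr 0, mul_one_div_cancel hq0.ne']
    have holder := tsum_prod_rpow_le_prod_tsum_rpow (fun k => q 0 * (w k * (1 / r k 0)))
      (fun k => mul_nonneg hq0.le (mul_nonneg (hw k) (one_div_pos.2 (hr k 0)).le)) hsum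
      (fun k i => mixedNorm m (fun j => r k j.succ) (fun is => a k (Fin.cons i is)) ^ r k 0)
    simp only [mixedNorm]
    calc _ ≤ (∑' i, ∏ k, (mixedNorm m (fun j => r k j.succ)
            (fun is => a k (Fin.cons i is)) ^ r k 0) ^ (q 0 * (w k * (1 / r k 0)))) ^ (1 / q 0) := by
          refine ENNReal.rpow_le_rpow (ENNReal.tsum_le_tsum fun i => ?_) (one_div_pos.2 hq0).le
          refine (ENNReal.rpow_le_rpow (ih i) hq0.le).trans_eq ?_
          rw [← ENNReal.prod_rpow_of_nonneg hq0.le]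
          refine Finset.prod_congr rfl fun k _ => ?_
          rw [← ENNReal.rpow_mul, ← ENNReal.rpow_mul]
          congr 1
          field_simp [(hr k 0).ne']
      _ ≤ _ := ENNReal.rpow_le_rpow holder (one_div_pos.2 hq0).le
      _ = _ := by
          rw [← ENNReal.prod_rpow_of_nonneg (one_div_pos.2 hq0).le]
          refine Finset.prod_congr rfl fun k _ => ?_
          rw [← ENNReal.rpow_mul, ← ENNReal.rpow_mul]
          congr 1
          field_simp

/-- **The general interpolation method (Proposition 2.1).** If a linear map `T` from a Banach
space `Z` into `Y`-valued families indexed by `ℕ^m` is bounded by `C` from `Z` into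
`ℓ_{q(k)}(Y)` for `k = 1, …, N`, then it is bounded by `C` from `Z` into `ℓ_q(Y)` whenever
`(1/q₁, …, 1/q_m)` lies in the convex hull of the points `(1/q₁(k), …, 1/q_m(k))`. -/
theorem interpolation_method (Z Y : Type*)
    [NormedAddCommGroup Z] [NormedSpace ℂ Z] [CompleteSpace Z]
    [NormedAddCommGroup Y] [NormedSpace ℂ Y] [CompleteSpace Y]
    (N m : ℕ) (hN : 1 ≤ N) (hm : 1 ≤ m)
    (qk : Fin N → Fin m → ℝ) (hqk : ∀ k j, 1 ≤ qk k j)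
    (T : Z →ₗ[ℂ] ((Fin m → ℕ) → Y)) (C : ℝ)
    (hT : ∀ k : Fin N, ∀ z : Z,
      mixedNorm m (qk k) (fun is => (‖T z is‖₊ : ℝ≥0∞)) ≤ ENNReal.ofReal (C * ‖z‖))
    (q : Fin m → ℝ) (hq : ∀ j, 1 < q j)
    (hconv : (fun j => 1 / q j) ∈ convexHull ℝ (Set.range fun k : Fin N => fun j => 1 / qk k j)) :
    ∀ z : Z, mixedNorm m q (fun is => (‖T z is‖₊ : ℝ≥0∞)) ≤ ENNReal.ofReal (C * ‖z‖) := by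
  intro z
  obtain ⟨ι, _, w, x, hw, hsum, hx, hwx⟩ := mem_convexHull_iff_exists_fintype.1 hconv
  choose κ hκ using hx
  have hqr : ∀ j, ∑ k, w k * (1 / qk (κ k) j) = 1 / q j := fun j => by
    simpa [← hκ] using congrFun hwx j
  have h := mixedNorm_prod_rpow_le_s6 w hw m q (fun k => qk (κ k))
    (fun j => zero_lt_one.trans (hq j)) (fun k j => zero_lt_one.trans_le (hqk _ j)) hqr
    (fun _ is => (‖T z is‖₊ : ℝ≥0∞))
  simp only [prod_rpow_eq_self_of_sum_eq_one w hw hsum] at h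
  calc _ ≤ _ := h
    _ ≤ ∏ k, ENNReal.ofReal (C * ‖z‖) ^ w k :=
      Finset.prod_le_prod' fun k _ => ENNReal.rpow_le_rpow (hT (κ k) z) (hw k)
    _ = _ := prod_rpow_eq_self_of_sum_eq_one w hw hsum _
end

section
/- Let Y be a Banach space, m ≥ 1, λ ∈ [1,2], and let (x_i)_{i∈ℕ^m} be a family in Y. Set M = max over j ∈ {1,…,m} of ( Σ_{i_j} ( Σ_{over all indices except i_j} ‖x_i‖² )^{λ/2} )^{1/λ}, and assume M < ∞. Then for every permutation σ of {1,…,m} and every k ∈ {1,…,m}, the iterated mixed norm ( Σ_{i_{σ(1)},…,i_{σ(k-1)}} ( Σ_{i_{σ(k)}} ( Σ_{i_{σ(k+1)},…,i_{σ(m)}} ‖x_i‖² )^{λ/2} )^{2/λ} )^{1/2} is at most M. In other words, the mixed norm of x with exponents (2,…,2,λ,2,…,2) (λ in the k-th position), taken with the summations performed in the order prescribed by any permutation σ, is bounded by the maximum over positions of the corresponding (λ, 2,…,2)-mixed norm. -/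
open scoped ENNReal NNReal

namespace ENNReal

/-- Minkowski's inequality for finite sums of vectors in a finite-dimensional `ℓ_p` space. -/
theorem finset_Lp_sum_le {ι κ : Type*} (s : Finset ι) (t : Finset κ) (c : ι → κ → ℝ≥0∞)
    {p : ℝ} (hp : 1 ≤ p) :
    (∑ i ∈ s, (∑ j ∈ t, c i j) ^ p) ^ (1 / p) ≤ ∑ j ∈ t, (∑ i ∈ s, c i j ^ p) ^ (1 / p) := by
  classical
  have hp0 : 0 < p := by linarith
  induction t using Finset.induction_on with
  | empty => simp [hp0]
  | insert j t hj ih =>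
    simp only [Finset.sum_insert hj]
    exact (ENNReal.Lp_add_le s _ _ hp).trans (by gcongr)

/-- Minkowski's inequality for double series. -/
theorem Lp_tsum_le_s9 {ι κ : Type*} (c : ι → κ → ℝ≥0∞) {p : ℝ} (hp : 1 ≤ p) :
    (∑' i, (∑' j, c i j) ^ p) ^ (1 / p) ≤ ∑' j, (∑' i, c i j ^ p) ^ (1 / p) := by
  have hp0 : 0 < p := by linarith
  rw [one_div, ENNReal.rpow_inv_le_iff hp0, ENNReal.tsum_eq_iSup_sum]
  refine iSup_le fun s => ?_
  have hlim : Filter.Tendsto (fun t : Finset κ => ∑ i ∈ s, (∑ j ∈ t, c i j) ^ p) Filter.atTop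
      (nhds (∑ i ∈ s, (∑' j, c i j) ^ p)) :=
    tendsto_finsetSum s fun i _ =>
      (ENNReal.continuous_rpow_const.tendsto _).comp ENNReal.summable.hasSum
  refine le_of_tendsto' hlim fun t => ?_
  rw [← ENNReal.rpow_inv_le_iff hp0, ← one_div]
  calc (∑ i ∈ s, (∑ j ∈ t, c i j) ^ p) ^ (1 / p)
      ≤ ∑ j ∈ t, (∑ i ∈ s, c i j ^ p) ^ (1 / p) := finset_Lp_sum_le s t c hp
    _ ≤ ∑ j ∈ t, (∑' i, c i j ^ p) ^ (1 / p) := by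
        gcongr
        exact ENNReal.sum_le_tsum s
    _ ≤ ∑' j, (∑' i, c i j ^ p) ^ (1 / p) := ENNReal.sum_le_tsum t

/-- Interchanging two nested `ℓ_q` norms so that the smaller exponent comes outside increases
the value. -/
theorem mixed_tsum_swap_le {ι κ : Type*} (b : ι → κ → ℝ≥0∞) {q r : ℝ} (hq : 0 < q)
    (hqr : q ≤ r) :
    (∑' i, ((∑' j, b i j ^ q) ^ (1 / q)) ^ r) ^ (1 / r) ≤
      (∑' j, ((∑' i, b i j ^ r) ^ (1 / r)) ^ q) ^ (1 / q) := by
  have hr : 0 < r := hq.trans_le hqr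
  have h := Lp_tsum_le_s9 (fun i j => b i j ^ q) ((one_le_div hq).2 hqr)
  have h' := ENNReal.rpow_le_rpow h (one_div_pos.2 hq).le
  simp only [← ENNReal.rpow_mul] at h' ⊢
  have e₁ : 1 / (r / q) * (1 / q) = 1 / r := by field_simp
  have e₂ : 1 / q * r = r / q := by field_simp
  have e₃ : q * (r / q) = r := by field_simp
  have e₄ : 1 / r * q = 1 / (r / q) := by field_simp
  rwa [e₁, e₃, ← e₄, ← e₂] at h'

end ENNReal

/-- Moving the smallest exponent to the front, together with its variable, increases the mixed
norm; the reordering of the variables does not depend on the family. -/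
theorem exists_perm_mixedNorm_le {q r : ℝ} (hq : 0 < q) (hqr : q ≤ r) (m : ℕ) (k : Fin m) :
    ∃ ρ : Equiv.Perm (Fin m), ∀ a : (Fin m → ℕ) → ℝ≥0∞,
      mixedNorm m (fun j => if j = k then q else r) a ≤
        mixedNorm m (fun j => if (j : ℕ) = 0 then q else r) (fun is => a (fun t => is (ρ t))) := by
  have hr : 0 < r := hq.trans_le hqr
  induction m with
  | zero => exact k.elim0
  | succ m ih =>
    cases k using Fin.cases with
    | zero => exact ⟨1, fun a => by simp [← Fin.val_eq_zero_iff]⟩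
    | succ k =>
      obtain ⟨ρ, hρ⟩ := ih k
      cases m with
      | zero => exact k.elim0
      | succ m =>
        refine ⟨(Equiv.Perm.decomposeFin.symm (0, ρ)).trans (Equiv.swap 0 1), fun a => ?_⟩
        have hcons (i j : ℕ) (is : Fin m → ℕ) :
            (fun t => (Fin.cons j (Fin.cons i is : Fin (m + 1) → ℕ) : Fin (m + 2) → ℕ)
              (((Equiv.Perm.decomposeFin.symm (0, ρ)).trans (Equiv.swap 0 1)) t)) =
            Fin.cons i (fun t => (Fin.cons j is : Fin (m + 1) → ℕ) (ρ t)) := by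
          have hswap (u : Fin (m + 2)) :
              (Fin.cons j (Fin.cons i is : Fin (m + 1) → ℕ) : Fin (m + 2) → ℕ)
                (Equiv.swap 0 1 u) =
              (Fin.cons i (Fin.cons j is : Fin (m + 1) → ℕ) : Fin (m + 2) → ℕ) u := by
            cases u using Fin.cases with
            | zero => rw [Equiv.swap_apply_left, ← Fin.succ_zero_eq_one]; simp
            | succ u =>
              cases u using Fin.cases with
              | zero => rw [Fin.succ_zero_eq_one, Equiv.swap_apply_right]; rfl
              | succ u =>
                rw [Equiv.swap_apply_of_ne_of_ne (Fin.succ_ne_zero _)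
                  (by rw [← Fin.succ_zero_eq_one]; exact fun h => Fin.succ_ne_zero _ (Fin.succ_injective _ h))]
                simp
          funext t
          rw [Equiv.trans_apply, hswap]
          cases t using Fin.cases with
          | zero => simp
          | succ t => simp
        calc mixedNorm (m + 2) (fun j => if j = k.succ then q else r) a
            = (∑' i, (mixedNorm (m + 1) (fun j => if j = k then q else r)
                (fun is => a (Fin.cons i is))) ^ r) ^ (1 / r) := by
              rw [mixedNorm]
              simp [(Fin.succ_ne_zero k).symm]
          _ ≤ (∑' i, (mixedNorm (m + 1) (fun j => if (j : ℕ) = 0 then q else r)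
                (fun is => a (Fin.cons i (fun t => is (ρ t))))) ^ r) ^ (1 / r) := by
              gcongr with i
              exact hρ fun is => a (Fin.cons i is)
          _ = (∑' i, ((∑' j, (mixedNorm m (fun _ => r) (fun is => a (Fin.cons i
                (fun t => (Fin.cons j is : Fin (m + 1) → ℕ) (ρ t))))) ^ q) ^ (1 / q)) ^ r)
                  ^ (1 / r) := by
              simp [mixedNorm]
          _ ≤ (∑' j, ((∑' i, (mixedNorm m (fun _ => r) (fun is => a (Fin.cons i
                (fun t => (Fin.cons j is : Fin (m + 1) → ℕ) (ρ t))))) ^ r) ^ (1 / r)) ^ q)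
                  ^ (1 / q) := ENNReal.mixed_tsum_swap_le _ hq hqr
          _ = _ := by
              simp only [mixedNorm, hcons]
              simp

/-- **Proposition 3.1 (consequence of Minkowski's inequality).** Let `Y` be a Banach space,
`m ≥ 1`, `λ ∈ [1,2]` and `x : ℕ^m → Y`. Suppose `M < ∞` bounds, for every permutation `τ`,
the mixed norm of `x` (summed in the order prescribed by `τ`) with exponents `(λ, 2, …, 2)`,
i.e. `(Σ_{i_j} (Σ_{remaining indices} ‖x_i‖²)^{λ/2})^{1/λ} ≤ M` for each position `j`. Then
for every permutation `σ` and every `k`, the mixed norm of `x` summed in the order prescribed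
by `σ` with exponents `(2, …, 2, λ, 2, …, 2)` (`λ` in the `k`-th position) is at most `M`. -/
theorem minkowski_permuted_mixed_norms (Y : Type*) [NormedAddCommGroup Y]
    (m : ℕ) (hm : 1 ≤ m) (lam : ℝ) (hlam1 : 1 ≤ lam) (hlam2 : lam ≤ 2)
    (x : (Fin m → ℕ) → Y) (M : ℝ≥0∞) (hMfin : M ≠ ⊤)
    (hM : ∀ τ : Equiv.Perm (Fin m),
      mixedNorm m (fun j => if (j : ℕ) = 0 then lam else 2)
        (fun is => (‖x (fun t => is (τ.symm t))‖₊ : ℝ≥0∞)) ≤ M) :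
    ∀ σ : Equiv.Perm (Fin m), ∀ k : Fin m,
      mixedNorm m (fun j => if j = k then lam else 2)
        (fun is => (‖x (fun t => is (σ.symm t))‖₊ : ℝ≥0∞)) ≤ M := by
  intro σ k
  obtain ⟨ρ, hρ⟩ := exists_perm_mixedNorm_le (by linarith) hlam2 m k
  exact (hρ _).trans (hM (σ.symm.trans ρ).symm)
end
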